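/- arXiv:0903.1588 — 6 statements merged into one kernel-verified Lean document; each statement's English description precedes it below -/
import Mathlib

section
/- Lemma 2. Let I_c be a nonempty finite index set; for each t in I_c let gamma_t > 0 and let U_t be a finite subset of the nonnegative integers with 0 in U_t and U_t^- = U_t \ {0} nonempty (so every i in U_t^- satisfies i >= 1). For each t in I_c and vector beta^{(t)} = (beta_i^{(t)})_{i in U_t}, define F_t(beta^{(t)}) = beta_0^{(t)} log(1/beta_0^{(t)}) - sum_{i in U_t^-} beta_i^{(t)} (with the convention 0 log(1/0) = 0). Then there exist constants k > 0 and eps > 0 such that: for every delta in [0, eps], every (eps_t)_{t in I_c} with eps_t >= 0 and sum_{t in I_c} eps_t = delta, and every family (beta^{(t)})_{t in I_c} satisfying beta_i^{(t)} >= 0 for all i in U_t, sum_{i in U_t} beta_i^{(t)} = 1, and sum_{i in U_t^-} i beta_i^{(t)} = eps_t / gamma_t, one has | sum_{t in I_c} gamma_t F_t(beta^{(t)}) | <= k delta^2. (I.e., sum_{t in I_c} gamma_t F_t(beta^{(t)}) is O(delta^2) uniformly over all vectors satisfying the optimization constraints.) -/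
open Finset

theorem aux_F (b s : ℝ) (hb : 0 ≤ b) (h : b + s = 1) :
    |b * Real.log (1 / b) - s| ≤ s ^ 2 := by
  obtain rfl : s = 1 - b := by linarith
  rcases hb.eq_or_lt with rfl | hb
  · norm_num
  · have h1 := Real.log_le_sub_one_of_pos hb
    have h2 := Real.log_le_sub_one_of_pos (x := 1 / b) (by positivity)
    have h3 : Real.log (1 / b) = - Real.log b := by rw [one_div, Real.log_inv]
    have h4 : b * Real.log (1 / b) ≤ b * (1 / b - 1) := by gcongr
    have h5 : b * (1 / b - 1) = 1 - b := by field_simp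
    have h6 : b * (1 - b) ≤ b * Real.log (1 / b) :=
      mul_le_mul_of_nonneg_left (by linarith) hb.le
    rw [abs_le]
    constructor <;> nlinarith [sq_nonneg (1 - b)]

/-- **Lemma 2.**  For each check-node type `t` let `γ_t > 0` and let `U_t ∋ 0` be a finite
set of nonnegative integers with `U_t⁻ = U_t \ {0}` nonempty, and set
`F_t(β^{(t)}) = β_0^{(t)} log(1/β_0^{(t)}) - ∑_{i ∈ U_t⁻} β_i^{(t)}`.  Then there are
`k, ε > 0` such that for every `δ ∈ [0,ε]`, every `(ε_t)` with `ε_t ≥ 0` and `∑ ε_t = δ`,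
and every family `(β^{(t)})` with `β^{(t)} ≥ 0`, `∑_{i ∈ U_t} β_i^{(t)} = 1` and
`∑_{i ∈ U_t⁻} i β_i^{(t)} = ε_t/γ_t`, one has `|∑_t γ_t F_t(β^{(t)})| ≤ k δ²`.
(The convention `0 · log(1/0) = 0` holds automatically in Lean.) -/
theorem lemma2_O_delta_sq (nc : ℕ) (hnc : 0 < nc)
    (U : Fin nc → Finset ℕ) (hU0 : ∀ t, 0 ∈ U t)
    (hUne : ∀ t, ((U t).erase 0).Nonempty)
    (γ : Fin nc → ℝ) (hγ : ∀ t, 0 < γ t) :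
    ∃ k : ℝ, 0 < k ∧ ∃ ε : ℝ, 0 < ε ∧
      ∀ δ : ℝ, 0 ≤ δ → δ ≤ ε →
      ∀ ev : Fin nc → ℝ, (∀ t, 0 ≤ ev t) → (∑ t, ev t = δ) →
      ∀ β : Fin nc → ℕ → ℝ,
        (∀ t, ∀ i ∈ U t, 0 ≤ β t i) →
        (∀ t, ∑ i ∈ U t, β t i = 1) →
        (∀ t, ∑ i ∈ (U t).erase 0, (i : ℝ) * β t i = ev t / γ t) →
        |∑ t, γ t * (β t 0 * Real.log (1 / β t 0) - ∑ i ∈ (U t).erase 0, β t i)| ≤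
          k * δ ^ 2 := by
  refine ⟨∑ t, 1 / γ t + 1, ?_, 1, one_pos, ?_⟩
  · have : 0 ≤ ∑ t, 1 / γ t := Finset.sum_nonneg fun t _ => (one_div_pos.2 (hγ t)).le
    linarith
  intro δ hδ _ ev hev hsum β hβ h1 h2
  have key : ∀ t, |γ t * (β t 0 * Real.log (1 / β t 0) - ∑ i ∈ (U t).erase 0, β t i)| ≤
      1 / γ t * δ ^ 2 := by
    intro t
    have hs := Finset.add_sum_erase (U t) (β t) (hU0 t)
    rw [h1 t] at hs
    have hF := aux_F _ _ (hβ t 0 (hU0 t)) hs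
    have hs0 : 0 ≤ ∑ i ∈ (U t).erase 0, β t i :=
      Finset.sum_nonneg fun i hi => hβ t i (Finset.mem_of_mem_erase hi)
    have hle : ∑ i ∈ (U t).erase 0, β t i ≤ δ / γ t := by
      calc ∑ i ∈ (U t).erase 0, β t i ≤ ∑ i ∈ (U t).erase 0, (i : ℝ) * β t i := by
            refine Finset.sum_le_sum fun i hi => ?_
            have hi1 : (1 : ℝ) ≤ i := by
              exact_mod_cast Nat.one_le_iff_ne_zero.2 (Finset.ne_of_mem_erase hi)
            exact le_mul_of_one_le_left (hβ t i (Finset.mem_of_mem_erase hi)) hi1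
        _ = ev t / γ t := h2 t
        _ ≤ δ / γ t := by
            have : ev t ≤ δ := hsum ▸ Finset.single_le_sum (fun i _ => hev i) (Finset.mem_univ t)
            exact div_le_div_of_nonneg_right this (hγ t).le
    rw [abs_mul, abs_of_pos (hγ t)]
    have hg := hγ t
    calc _ ≤ γ t * (δ / γ t) ^ 2 :=
          mul_le_mul_of_nonneg_left (hF.trans (pow_le_pow_left₀ hs0 hle 2)) hg.le
      _ = 1 / γ t * δ ^ 2 := by field_simp
  calc _ ≤ ∑ t, |γ t * (β t 0 * Real.log (1 / β t 0) - ∑ i ∈ (U t).erase 0, β t i)| :=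
        Finset.abs_sum_le_sum_abs _ _
    _ ≤ ∑ t, 1 / γ t * δ ^ 2 := Finset.sum_le_sum fun t _ => key t
    _ ≤ _ := by
      rw [← Finset.sum_mul]
      nlinarith [sq_nonneg δ]
end

section
/- Lemma 4. Let I_v be a nonempty finite index set; for each t in I_v let delta_t > 0 and let S_t be a finite subset of N^2 with (0,0) in S_t and S_t^- = S_t \ {(0,0)} nonempty and contained in {(i,j) : i >= 1}. For each t in I_v and vector eta^{(t)} = (eta_{i,j}^{(t)})_{(i,j) in S_t}, define F_t(eta^{(t)}) = eta_{0,0}^{(t)} log(1/eta_{0,0}^{(t)}) - sum_{(i,j) in S_t^-} eta_{i,j}^{(t)} (with the convention 0 log(1/0) = 0). Then there exist constants k > 0 and eps > 0 such that: for every alpha in [0, eps], every (alpha_t)_{t in I_v} with alpha_t >= 0 and sum_{t in I_v} alpha_t = alpha, any reals beta_t >= 0, and every family (eta^{(t)})_{t in I_v} satisfying eta_{i,j}^{(t)} >= 0 for all (i,j) in S_t, sum_{(i,j) in S_t} eta_{i,j}^{(t)} = 1, sum_{(i,j) in S_t^-} i eta_{i,j}^{(t)} = alpha_t / delta_t, and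 sum_{(i,j) in S_t^-} j eta_{i,j}^{(t)} = beta_t / delta_t, one has | sum_{t in I_v} delta_t F_t(eta^{(t)}) | <= k alpha^2. (I.e., sum_{t in I_v} delta_t F_t(eta^{(t)}) is O(alpha^2) uniformly over all vectors satisfying the optimization constraints.) -/
open Finset

/-- **Lemma 4.**  For each variable-node type `t` let `δ_t > 0` and let `S_t ∋ (0,0)` be a
finite subset of `ℕ²` with `S_t⁻ = S_t \ {(0,0)}` nonempty and contained in
`{(i,j) : i ≥ 1}`, and set
`F_t(η^{(t)}) = η_{0,0}^{(t)} log(1/η_{0,0}^{(t)}) - ∑_{(i,j) ∈ S_t⁻} η_{i,j}^{(t)}`.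
Then there are `k, ε > 0` such that for every `α ∈ [0,ε]`, every `(α_t)` with `α_t ≥ 0`
and `∑ α_t = α`, any reals `β_t ≥ 0`, and every family `(η^{(t)})` with `η^{(t)} ≥ 0`,
`∑_{S_t} η^{(t)} = 1`, `∑_{S_t⁻} i η_{i,j}^{(t)} = α_t/δ_t` and
`∑_{S_t⁻} j η_{i,j}^{(t)} = β_t/δ_t`, one has `|∑_t δ_t F_t(η^{(t)})| ≤ k α²`. -/
theorem lemma4_O_alpha_sq (nv : ℕ) (hnv : 0 < nv)
    (S : Fin nv → Finset (ℕ × ℕ)) (hS0 : ∀ t, (0, 0) ∈ S t)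
    (hSne : ∀ t, ((S t).erase (0, 0)).Nonempty)
    (hSi : ∀ t, ∀ ij ∈ (S t).erase (0, 0), 1 ≤ ij.1)
    (δ : Fin nv → ℝ) (hδ : ∀ t, 0 < δ t) :
    ∃ k : ℝ, 0 < k ∧ ∃ ε : ℝ, 0 < ε ∧
      ∀ α : ℝ, 0 ≤ α → α ≤ ε →
      ∀ av : Fin nv → ℝ, (∀ t, 0 ≤ av t) → (∑ t, av t = α) →
      ∀ bv : Fin nv → ℝ, (∀ t, 0 ≤ bv t) →
      ∀ η : Fin nv → ℕ × ℕ → ℝ,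
        (∀ t, ∀ ij ∈ S t, 0 ≤ η t ij) →
        (∀ t, ∑ ij ∈ S t, η t ij = 1) →
        (∀ t, ∑ ij ∈ (S t).erase (0, 0), (ij.1 : ℝ) * η t ij = av t / δ t) →
        (∀ t, ∑ ij ∈ (S t).erase (0, 0), (ij.2 : ℝ) * η t ij = bv t / δ t) →
        |∑ t, δ t * (η t (0, 0) * Real.log (1 / η t (0, 0)) -
            ∑ ij ∈ (S t).erase (0, 0), η t ij)| ≤ k * α ^ 2 := by
  have hk : 0 ≤ ∑ t, 1 / δ t := Finset.sum_nonneg fun t _ => (one_div_pos.2 (hδ t)).le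
  refine ⟨1 + ∑ t, 1 / δ t, by linarith, 1, one_pos, ?_⟩
  intro α hα _ av hav hsum bv _ η hη h1 hi _
  have key : ∀ t, |δ t * (η t (0, 0) * Real.log (1 / η t (0, 0)) -
      ∑ ij ∈ (S t).erase (0, 0), η t ij)| ≤ 1 / δ t * α ^ 2 := by
    intro t
    have hd := hδ t
    have hx : 0 ≤ η t (0, 0) := hη t _ (hS0 t)
    have hadd := Finset.add_sum_erase (S t) (η t) (hS0 t)
    rw [h1 t] at hadd
    have hs0 : 0 ≤ ∑ ij ∈ (S t).erase (0, 0), η t ij :=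
      Finset.sum_nonneg fun ij h => hη t ij (Finset.mem_of_mem_erase h)
    have hsle : ∑ ij ∈ (S t).erase (0, 0), η t ij ≤ av t / δ t := by
      rw [← hi t]
      refine Finset.sum_le_sum fun ij h => ?_
      have h2 : (1 : ℝ) ≤ ij.1 := by exact_mod_cast hSi t ij h
      exact le_mul_of_one_le_left (hη t ij (Finset.mem_of_mem_erase h)) h2
    have hava : av t ≤ α := by
      rw [← hsum]
      exact Finset.single_le_sum (f := av) (fun i _ => hav i) (Finset.mem_univ t)
    generalize (∑ ij ∈ (S t).erase (0, 0), η t ij) = s at *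
    generalize η t (0, 0) = x at *
    have hsa : s ≤ α / δ t := hsle.trans (by gcongr)
    have hF : |x * Real.log (1 / x) - s| ≤ s ^ 2 := by
      rcases hx.eq_or_lt with h0 | h0
      · subst h0
        have : s = 1 := by linarith
        simp [this]
      · have a := Real.log_le_sub_one_of_pos h0
        have b := Real.log_le_sub_one_of_pos (one_div_pos.2 h0)
        have b2 := mul_le_mul_of_nonneg_left b hx
        have e : x * (1 / x - 1) = 1 - x := by field_simp
        have a2 := mul_le_mul_of_nonneg_left a hx
        have e2 : Real.log (1 / x) = - Real.log x := by simp
        rw [e] at b2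
        have hxs : x = 1 - s := by linarith
        rw [abs_le]
        constructor
        · rw [e2]; rw [hxs] at a2 ⊢; nlinarith
        · nlinarith [sq_nonneg s]
    rw [abs_mul, abs_of_pos hd]
    calc δ t * |x * Real.log (1 / x) - s| ≤ δ t * (α / δ t) ^ 2 := by
          gcongr
          exact hF.trans (by gcongr)
      _ = 1 / δ t * α ^ 2 := by field_simp
  calc _ ≤ ∑ t, 1 / δ t * α ^ 2 :=
        (Finset.abs_sum_le_sum_abs _ _).trans (Finset.sum_le_sum fun t _ => key t)
    _ ≤ _ := by
        rw [← Finset.sum_mul]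
        nlinarith [sq_nonneg α]
end

section
/- Exponential growth rate of the number of check-valid assignments. Let I_c be a nonempty finite set; for each t in I_c let A^{(t)}(x) = 1 + sum_{u=r_t}^{s_t} A_u^{(t)} x^u with integers 2 <= r_t <= s_t, A_u^{(t)} >= 0, A_{r_t}^{(t)} > 0, and let gamma_t > 0 with sum_{t in I_c} gamma_t = 1; set A_0^{(t)} = 1, U_t = { i : A_i^{(t)} > 0 } (so 0 in U_t) and U_t^- = U_t \ {0}. Fix a positive rational delta such that the set M of positive integers m with gamma_t m an integer for every t, delta m an integer, and Coeff[ prod_{t in I_c} (A^{(t)}(x))^{gamma_t m}, x^{delta m} ] > 0 is infinite. Then the limit over m in M, as m -> infinity, of (1/m) log Coeff[ prod_{t in I_c} (A^{(t)}(x))^{gamma_t m}, x^{delta m} ] exists and equals W(delta) := max over (eps_t)_{t in I_c} with eps_t >= 0 and sum_t eps_t = delta of sum_{t in I_c} gamma_t max over beta^{(t)} of sum_{i in U_t} beta_i^{(t)} log( A_i^{(t)} / beta_i^{(t)} ), where for each t the inner maximization over beta^{(t)} = (beta_i^{(t)})_{i in U_t} is subject to beta_i^{(t)} >= 0, sum_{i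 in U_t} beta_i^{(t)} = 1, and sum_{i in U_t^-} i beta_i^{(t)} = eps_t / gamma_t (terms with beta_i^{(t)} = 0 are interpreted as 0). -/
open Polynomial Filter Finset
open scoped Classical

namespace GR

def NN (p : ℝ[X]) : Prop := ∀ i, 0 ≤ p.coeff i

lemma NN.mul {p q : ℝ[X]} (hp : NN p) (hq : NN q) : NN (p * q) := by
  intro n
  rw [coeff_mul]
  exact Finset.sum_nonneg fun x _ => mul_nonneg (hp _) (hq _)

lemma NN.one : NN 1 := by
  intro i
  rw [coeff_one]
  split_ifs <;> norm_num

lemma NN.pow {p : ℝ[X]} (hp : NN p) (k : ℕ) : NN (p ^ k) := by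
  induction k with
  | zero => simpa using NN.one
  | succ k ih => rw [pow_succ]; exact ih.mul hp

lemma NN.prod {ι : Type*} (S : Finset ι) (f : ι → ℝ[X]) (h : ∀ t, NN (f t)) :
    NN (∏ t ∈ S, f t) := by
  induction S using Finset.induction_on with
  | empty => simpa using NN.one
  | insert a S ha ih => rw [Finset.prod_insert ha]; exact (h a).mul ih

lemma coeff_mul_ge {p q : ℝ[X]} (hp : NN p) (hq : NN q) (i j : ℕ) :
    p.coeff i * q.coeff j ≤ (p * q).coeff (i + j) := by
  rw [coeff_mul]
  exact Finset.single_le_sum (f := fun x : ℕ × ℕ => p.coeff x.1 * q.coeff x.2)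
    (fun x _ => mul_nonneg (hp _) (hq _)) (a := (i, j)) (by simp)

lemma coeff_pow_ge {p : ℝ[X]} (hp : NN p) (j n : ℕ) :
    p.coeff j ^ n ≤ (p ^ n).coeff (j * n) := by
  induction n with
  | zero => simp
  | succ n ih =>
    rw [pow_succ, pow_succ, Nat.mul_succ]
    exact (mul_le_mul_of_nonneg_right ih (hp j)).trans (coeff_mul_ge (hp.pow n) hp _ _)

lemma coeff_le_eval {p : ℝ[X]} (hp : NN p) (n : ℕ) {x : ℝ} (hx : 0 < x) :
    p.coeff n * x ^ n ≤ p.eval x := by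
  rw [eval_eq_sum, Polynomial.sum]
  by_cases h : n ∈ p.support
  · exact Finset.single_le_sum (f := fun n => p.coeff n * x ^ n)
      (fun i _ => mul_nonneg (hp i) (by positivity)) h
  · rw [notMem_support_iff.1 h, zero_mul]
    exact Finset.sum_nonneg fun i _ => mul_nonneg (hp i) (by positivity)

lemma le_one_of_pow (b : ℝ) (N : ℕ) (h : ∀ k : ℕ, b ^ k ≤ k * N + 1) : b ≤ 1 := by
  by_contra! hb
  have h1 := tendsto_pow_const_div_const_pow_of_one_lt 1 hb
  have h0 := tendsto_pow_const_div_const_pow_of_one_lt 0 hb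
  have h2 : Tendsto (fun k : ℕ => ((k : ℝ) ^ 1 / b ^ k) * N + (k : ℝ) ^ 0 / b ^ k) atTop
      (nhds (0 * N + 0)) := (h1.mul_const _).add h0
  have h3 : (1 : ℝ) ≤ 0 * N + 0 := by
    refine ge_of_tendsto' h2 fun k => ?_
    have hk : 0 < b ^ k := by positivity
    have : ((k : ℝ) ^ 1 / b ^ k) * N + (k : ℝ) ^ 0 / b ^ k = (k * N + 1) / b ^ k := by
      simp; field_simp
    rw [this, le_div_iff₀ hk, one_mul]
    exact h k
  norm_num at h3

lemma key {P : ℝ[X]} (hP : NN P) (d : ℕ) (i j : ℕ) (hi : i < d) (hj : d < j)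
    (hPi : 0 < P.coeff i) (hPj : 0 < P.coeff j) (L : ℝ)
    (hL : ∀ k : ℕ, (P ^ k).coeff (k * d) ≤ Real.exp (L * k)) :
    ∃ z : ℝ, P.eval (Real.exp (-z)) ≤ Real.exp (L - z * d) := by
  let Sp : Set ℝ := {r | ∃ k l e : ℕ, 0 < e ∧ l = k * d + e ∧ 0 < (P ^ k).coeff l ∧
    r = (Real.log ((P ^ k).coeff l) - L * k) / e}
  let Sm : Set ℝ := {r | ∃ k l e : ℕ, 0 < e ∧ l + e = k * d ∧ 0 < (P ^ k).coeff l ∧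
    r = -(Real.log ((P ^ k).coeff l) - L * k) / e}
  have hlt : ∀ r ∈ Sp, ∀ r' ∈ Sm, r ≤ r' := by
    rintro r ⟨k, l, e, he, hl, hc, rfl⟩ r' ⟨k', l', e', he', hl', hc', rfl⟩
    have h1 : (P ^ k).coeff l ^ e' * (P ^ k').coeff l' ^ e ≤
        (P ^ (k * e' + k' * e)).coeff ((k * e' + k' * e) * d) := by
      have h2 := coeff_pow_ge (hP.pow k) l e'
      have h3 := coeff_pow_ge (hP.pow k') l' e
      have h4 := coeff_mul_ge ((hP.pow k).pow e') ((hP.pow k').pow e) (l * e') (l' * e)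
      have h5 : l * e' + l' * e = (k * e' + k' * e) * d := by
        subst hl
        calc (k * d + e) * e' + l' * e = k * d * e' + (l' + e') * e := by ring
          _ = _ := by rw [hl']; ring
      rw [h5, ← pow_mul, ← pow_mul, ← pow_add] at h4
      rw [← pow_mul] at h2 h3
      exact (mul_le_mul h2 h3 (by positivity) (hP.pow _ _)).trans h4
    have h2 := h1.trans (hL _)
    have h3 := Real.log_le_log (by positivity) h2
    rw [Real.log_exp, Real.log_mul (by positivity) (by positivity), Real.log_pow,
      Real.log_pow] at h3
    push_cast at h3
    have e0 : (0 : ℝ) < e := by exact_mod_cast he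
    have e0' : (0 : ℝ) < e' := by exact_mod_cast he'
    rw [div_le_div_iff₀ e0 e0']
    linarith
  have hpne : Sp.Nonempty := ⟨_, 1, j, j - d, by omega, by omega, by simpa using hPj, rfl⟩
  have hmne : Sm.Nonempty := ⟨_, 1, i, d - i, by omega, by omega, by simpa using hPi, rfl⟩
  obtain ⟨r0, hr0⟩ := hmne
  have hbdd : BddAbove Sp := ⟨r0, fun r hr => hlt r hr r0 hr0⟩
  refine ⟨sSup Sp, ?_⟩
  set z := sSup Sp with hz
  have hmain : ∀ k l : ℕ, 0 < (P ^ k).coeff l →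
      Real.log ((P ^ k).coeff l) ≤ L * k + z * (l - k * d) := by
    intro k l hc
    rcases lt_trichotomy l (k * d) with h | h | h
    · obtain ⟨e, he⟩ := Nat.exists_eq_add_of_lt h
      have hm : -(Real.log ((P ^ k).coeff l) - L * k) / ((e + 1 : ℕ) : ℝ) ∈ Sm :=
        ⟨k, l, e + 1, by omega, by omega, hc, rfl⟩
      have := csSup_le hpne fun r hr => hlt r hr _ hm
      rw [← hz] at this
      have e0 : (0 : ℝ) < ((e + 1 : ℕ) : ℝ) := by positivity
      rw [le_div_iff₀ e0] at this
      have he' : (k : ℝ) * d = l + ((e + 1 : ℕ) : ℝ) := by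
        rw [← Nat.cast_mul, he]; push_cast; ring
      rw [he']; linarith
    · have := Real.log_le_log hc (h ▸ hL k)
      rw [Real.log_exp] at this
      have : (l : ℝ) = k * d := by rw [h]; push_cast; ring
      rw [this]; linarith
    · obtain ⟨e, he⟩ := Nat.exists_eq_add_of_lt h
      have hm : (Real.log ((P ^ k).coeff l) - L * k) / ((e + 1 : ℕ) : ℝ) ∈ Sp :=
        ⟨k, l, e + 1, by omega, by omega, hc, rfl⟩
      have := le_csSup hbdd hm
      rw [← hz] at this
      have e0 : (0 : ℝ) < ((e + 1 : ℕ) : ℝ) := by positivity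
      rw [div_le_iff₀ e0] at this
      have he' : (l : ℝ) = k * d + ((e + 1 : ℕ) : ℝ) := by
        rw [he]; push_cast; ring
      rw [he']; linarith
  have hpow : ∀ k : ℕ, (P.eval (Real.exp (-z)) / Real.exp (L - z * d)) ^ k ≤
      k * P.natDegree + 1 := by
    intro k
    rw [div_pow, div_le_iff₀ (by positivity), ← eval_pow,
      eval_eq_sum_range' (n := k * P.natDegree + 1)
        (Nat.lt_succ_of_le natDegree_pow_le)]
    have : ∀ l ∈ Finset.range (k * P.natDegree + 1),
        (P ^ k).coeff l * Real.exp (-z) ^ l ≤ Real.exp (L - z * d) ^ k := by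
      intro l _
      rcases (hP.pow k l).lt_or_eq with h | h
      · rw [← Real.exp_log h, ← Real.exp_nat_mul, ← Real.exp_nat_mul, ← Real.exp_add]
        apply Real.exp_le_exp.2
        have := hmain k l h
        linarith
      · rw [← h, zero_mul]; positivity
    have := Finset.sum_le_card_nsmul _ _ _ this
    simpa using this
  have := le_one_of_pow _ _ hpow
  rwa [div_le_one (by positivity)] at this

lemma eval_pos' {p : ℝ[X]} (hp : NN p) (h0 : p.coeff 0 = 1) {x : ℝ} (hx : 0 ≤ x) :
    0 < p.eval x := by
  have : p.coeff 0 * x ^ 0 ≤ p.eval x := by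
    rw [eval_eq_sum, Polynomial.sum]
    exact Finset.single_le_sum (f := fun n => p.coeff n * x ^ n)
      (fun i _ => mul_nonneg (hp i) (by positivity)) (by simp [h0])
  rw [h0] at this
  norm_num at this
  linarith

lemma gibbs {p : ℝ[X]} (hp : NN p) (h0 : p.coeff 0 = 1) (β : ℕ → ℝ) (hβ : ∀ i, 0 ≤ β i)
    (h1 : ∑ i ∈ p.support, β i = 1) {x : ℝ} (hx : 0 < x) :
    ∑ i ∈ p.support, β i * Real.log (p.coeff i / β i) ≤
      Real.log (p.eval x) - (∑ i ∈ p.support, (i : ℝ) * β i) * Real.log x := by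
  have hZ := eval_pos' hp h0 hx.le
  set Z := p.eval x with hZd
  have hZs : Z = ∑ i ∈ p.support, p.coeff i * x ^ i := by
    rw [hZd, eval_eq_sum, Polynomial.sum]
  have hterm : ∀ i ∈ p.support, β i * Real.log (p.coeff i / β i) ≤
      β i * Real.log Z - (i * β i) * Real.log x + (p.coeff i * x ^ i / Z - β i) := by
    intro i hi
    have hc : 0 < p.coeff i := lt_of_le_of_ne (hp i) (Ne.symm (mem_support_iff.1 hi))
    rcases (hβ i).lt_or_eq with h | h
    · have := Real.log_le_sub_one_of_pos (x := p.coeff i * x ^ i / Z / β i) (by positivity)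
      have h3 := mul_le_mul_of_nonneg_left this h.le
      rw [mul_sub, mul_div_cancel₀ _ h.ne', Real.log_div (by positivity) (by positivity),
        Real.log_div (by positivity) (by positivity),
        Real.log_mul (by positivity) (by positivity), Real.log_pow] at h3
      rw [Real.log_div (by positivity) (by positivity)]
      linarith
    · rw [← h]
      have : 0 ≤ p.coeff i * x ^ i / Z := by positivity
      simpa using this
  refine (Finset.sum_le_sum hterm).trans (le_of_eq ?_)
  rw [Finset.sum_add_distrib, Finset.sum_sub_distrib, Finset.sum_sub_distrib, ← Finset.sum_mul,
    ← Finset.sum_mul, ← Finset.sum_div, ← hZs, h1, div_self hZ.ne']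
  ring

lemma gibbs_sum {p : ℝ[X]} (hp : NN p) (h0 : p.coeff 0 = 1) {x : ℝ} (hx : 0 < x) :
    ∑ i ∈ p.support, p.coeff i * x ^ i / p.eval x = 1 := by
  have hZ := eval_pos' hp h0 hx.le
  rw [← Finset.sum_div, div_eq_one_iff_eq hZ.ne', eval_eq_sum, Polynomial.sum]

lemma gibbs_mean (p : ℝ[X]) (x : ℝ) :
    ∑ i ∈ p.support, (i : ℝ) * (p.coeff i * x ^ i / p.eval x) =
      (X * derivative p).eval x / p.eval x := by
  have : (X * derivative p).eval x = ∑ i ∈ p.support, (i : ℝ) * (p.coeff i * x ^ i) := by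
    rw [eval_mul, eval_X, derivative_eval, Polynomial.sum, Finset.mul_sum]
    refine Finset.sum_congr rfl fun i _ => ?_
    rcases i with _ | i
    · simp
    · simp [pow_succ]; ring
  rw [this, Finset.sum_div]
  exact Finset.sum_congr rfl fun i _ => by ring

lemma gibbs_eq {p : ℝ[X]} (hp : NN p) (h0 : p.coeff 0 = 1) {x : ℝ} (hx : 0 < x) :
    ∑ i ∈ p.support, (p.coeff i * x ^ i / p.eval x) *
        Real.log (p.coeff i / (p.coeff i * x ^ i / p.eval x)) =
      Real.log (p.eval x) - (X * derivative p).eval x / p.eval x * Real.log x := by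
  have hZ := eval_pos' hp h0 hx.le
  have hterm : ∀ i ∈ p.support, (p.coeff i * x ^ i / p.eval x) *
        Real.log (p.coeff i / (p.coeff i * x ^ i / p.eval x)) =
      (p.coeff i * x ^ i / p.eval x) * Real.log (p.eval x) -
        (i * (p.coeff i * x ^ i / p.eval x)) * Real.log x := by
    intro i hi
    have hc : 0 < p.coeff i := lt_of_le_of_ne (hp i) (Ne.symm (mem_support_iff.1 hi))
    have : p.coeff i / (p.coeff i * x ^ i / p.eval x) = p.eval x / x ^ i := by
      field_simp
    rw [this, Real.log_div (by positivity) (by positivity), Real.log_pow]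
    ring
  rw [Finset.sum_congr rfl hterm, Finset.sum_sub_distrib, ← Finset.sum_mul, ← Finset.sum_mul,
    gibbs_sum hp h0 hx, gibbs_mean]
  ring

lemma fekete (M : Set ℕ) (g : ℕ → ℝ) (W : ℝ)
    (hadd : ∀ m ∈ M, ∀ n ∈ M, m + n ∈ M ∧ g m + g n ≤ g (m + n))
    (hpos : ∀ m ∈ M, 0 < m)
    (hub : ∀ m ∈ M, g m ≤ m * W)
    (hlb : ∀ ε > 0, ∃ n ∈ M, n * (W - ε) ≤ g n) :
    Tendsto (fun m : ℕ => (1 / (m : ℝ)) * g m) (atTop ⊓ 𝓟 M) (nhds W) := by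
  rw [Metric.tendsto_nhds]
  intro ε hε
  obtain ⟨n, hn, hgn⟩ := hlb (ε / 2) (by positivity)
  have hn0 := hpos n hn
  let h : ℕ → ℝ := fun m => g m - m * (W - ε / 2)
  let rep : ℕ → ℕ := fun c => sInf {m | m ∈ M ∧ m % n = c}
  obtain ⟨C, hC⟩ : ∃ C : ℝ, ∀ c < n, C ≤ h (rep c) := by
    obtain ⟨C, hC⟩ := ((Finset.range n).image (fun c => h (rep c))).bddBelow
    exact ⟨C, fun c hc => hC (by simpa using ⟨c, hc, rfl⟩)⟩
  have hstep : ∀ q : ℕ, ∀ r ∈ M, r + q * n ∈ M ∧ h r ≤ h (r + q * n) := by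
    intro q
    induction q with
    | zero => intro r hr; simpa using hr
    | succ q ih =>
      intro r hr
      obtain ⟨h1, h2⟩ := ih r hr
      obtain ⟨h3, h4⟩ := hadd _ h1 n hn
      have e : r + (q + 1) * n = r + q * n + n := by ring
      rw [e]
      refine ⟨h3, h2.trans ?_⟩
      simp only [h]
      push_cast at h4 ⊢
      linarith
  have hlow : ∀ m ∈ M, C ≤ h m := by
    intro m hm
    have hmem : m ∈ {k | k ∈ M ∧ k % n = m % n} := ⟨hm, rfl⟩
    have hr := Nat.sInf_mem ⟨m, hmem⟩
    have hle : rep (m % n) ≤ m := Nat.sInf_le hmem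
    have hr' : rep (m % n) ∈ M ∧ rep (m % n) % n = m % n := hr
    have h1 := (hstep ((m - rep (m % n)) / n) _ hr'.1).2
    have hd : n ∣ m - rep (m % n) := (Nat.modEq_iff_dvd' hle).1 hr'.2
    rw [Nat.div_mul_cancel hd, Nat.add_sub_cancel' hle] at h1
    exact (hC _ (Nat.mod_lt _ hn0)).trans h1
  have hev : ∀ᶠ m : ℕ in atTop, -C < (m : ℝ) * (ε / 2) := by
    have : Tendsto (fun m : ℕ => (m : ℝ) * (ε / 2)) atTop atTop :=
      tendsto_natCast_atTop_atTop.atTop_mul_const (by positivity)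
    exact this.eventually_gt_atTop _
  rw [eventually_inf_principal]
  filter_upwards [hev] with m hm hmM
  have hm0 : (0 : ℝ) < m := by exact_mod_cast hpos m hmM
  have h1 := hlow m hmM
  have h2 := hub m hmM
  simp only [h] at h1
  rw [Real.dist_eq, abs_lt, one_div, inv_mul_eq_div]
  constructor
  · have : W - ε < g m / m := by
      rw [lt_div_iff₀ hm0]; linarith
    linarith
  · have : g m / m ≤ W := by
      rw [div_le_iff₀ hm0]; linarith
    linarith

lemma nat_deg_facts {p : ℝ[X]} (hd : 0 < p.natDegree) :
    Tendsto (fun x : ℝ => (X * derivative p).eval x / p.eval x) atTop (nhds (p.natDegree : ℝ)) := by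
  have hp0 : p ≠ 0 := by rintro rfl; simp at hd
  have hdp : (derivative p).degree = (p.natDegree - 1 : ℕ) := degree_derivative hd.ne'
  have hdp' : (derivative p).natDegree = p.natDegree - 1 := natDegree_eq_of_degree_eq_some hdp
  have hdp0 : derivative p ≠ 0 := by intro h; rw [h] at hdp; simp at hdp
  have hdeg : (X * derivative p).degree = p.degree := by
    rw [degree_mul, degree_X, hdp, degree_eq_natDegree hp0]
    norm_cast; omega
  have := div_tendsto_atTop_leadingCoeff_div_of_degree_eq (X * derivative p) p hdeg
  convert this using 2
  have hl : p.leadingCoeff ≠ 0 := leadingCoeff_ne_zero.2 hp0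
  rw [eq_div_iff hl, leadingCoeff_mul, leadingCoeff_X, one_mul, leadingCoeff, leadingCoeff, hdp',
    coeff_derivative]
  rw [Nat.sub_add_cancel hd]
  have : ((p.natDegree - 1 : ℕ) : ℝ) + 1 = p.natDegree := by
    norm_cast; omega
  rw [this]; ring

lemma log_lead {p : ℝ[X]} (hp : NN p) (h0 : p.coeff 0 = 1) :
    Tendsto (fun x : ℝ => Real.log (p.eval x) - p.natDegree * Real.log x) atTop
      (nhds (Real.log p.leadingCoeff)) := by
  have hp0 : p ≠ 0 := by rintro rfl; simp at h0
  have h1 := div_tendsto_atTop_leadingCoeff_div_of_degree_eq p (X ^ p.natDegree)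
    (by rw [degree_X_pow, degree_eq_natDegree hp0])
  have hl : p.leadingCoeff ≠ 0 := leadingCoeff_ne_zero.2 hp0
  simp only [leadingCoeff_X_pow, div_one] at h1
  have h2 := h1.log hl
  refine h2.congr' ?_
  filter_upwards [eventually_gt_atTop 0] with x hx
  have hZ := eval_pos' hp h0 hx.le
  rw [eval_pow, eval_X, Real.log_div hZ.ne' (by positivity), Real.log_pow]

end GR


/-- **Exponential growth rate of the number of check-valid assignments.**
For check-node types `t ∈ Fin nc` with weight enumerators
`A^{(t)}(x) = 1 + ∑_{u=r_t}^{s_t} A_u^{(t)} x^u` and fractions `γ_t > 0`, `∑ γ_t = 1`,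
and a positive rational `δ` such that the set `M` of positive integers `m` with the
`γ_t m` and `δ m` integral and `Coeff[∏_t (A^{(t)})^{γ_t m}, x^{δ m}] > 0` is infinite,
the limit of `(1/m) log Coeff[∏_t (A^{(t)})^{γ_t m}, x^{δ m}]` over `m ∈ M` exists and
equals the (jointly encoded) nested maximum
`W(δ) = max_{ε: ∑ ε_t = δ} ∑_t γ_t max_{β^{(t)}} ∑_{i ∈ U_t} β_i^{(t)} log(A_i^{(t)}/β_i^{(t)})`
subject to `β^{(t)} ≥ 0`, `∑_{U_t} β^{(t)} = 1`, `∑_{U_t⁻} i β_i^{(t)} = ε_t/γ_t`. -/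
theorem growth_rate_check_valid_assignments (nc : ℕ) (hnc : 0 < nc)
    (s rd : Fin nc → ℕ) (A : Fin nc → ℕ → ℝ)
    (h_rd2 : ∀ t, 2 ≤ rd t) (h_rds : ∀ t, rd t ≤ s t)
    (hA0 : ∀ t, A t 0 = 1) (hAr : ∀ t, 0 < A t (rd t))
    (hAnn : ∀ t u, rd t ≤ u → u ≤ s t → 0 ≤ A t u)
    (hAsupp : ∀ t u, u ≠ 0 → u < rd t ∨ s t < u → A t u = 0)
    (γ : Fin nc → ℝ) (hγ : ∀ t, 0 < γ t) (hγ1 : ∑ t, γ t = 1)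
    (Ap : Fin nc → Polynomial ℝ)
    (hAp : ∀ t, Ap t = ∑ u ∈ Finset.range (s t + 1), Polynomial.C (A t u) * Polynomial.X ^ u)
    (δq : ℚ) (hδq : 0 < δq)
    (Mset : Set ℕ)
    (hMset : Mset = {m : ℕ | 0 < m ∧ (∀ t, ((⌊γ t * (m : ℝ)⌋₊ : ℝ) = γ t * m)) ∧
      ((⌊δq * (m : ℚ)⌋₊ : ℚ) = δq * m) ∧
      0 < (∏ t, Ap t ^ ⌊γ t * (m : ℝ)⌋₊).coeff ⌊δq * (m : ℚ)⌋₊})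
    (hMinf : Mset.Infinite) :
    ∃ W : ℝ,
      IsGreatest {x : ℝ | ∃ (ev : Fin nc → ℝ) (β : Fin nc → ℕ → ℝ),
        (∀ t, 0 ≤ ev t) ∧ (∑ t, ev t = (δq : ℝ)) ∧
        (∀ t i, 0 ≤ β t i) ∧
        (∀ t, ∑ i ∈ (Finset.range (s t + 1)).filter (fun i => 0 < A t i), β t i = 1) ∧
        (∀ t, ∑ i ∈ ((Finset.range (s t + 1)).filter (fun i => 0 < A t i)).erase 0,
          (i : ℝ) * β t i = ev t / γ t) ∧
        x = ∑ t, γ t * ∑ i ∈ (Finset.range (s t + 1)).filter (fun i => 0 < A t i),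
          β t i * Real.log (A t i / β t i)} W ∧
      Filter.Tendsto
        (fun m : ℕ => (1 / (m : ℝ)) *
          Real.log ((∏ t, Ap t ^ ⌊γ t * (m : ℝ)⌋₊).coeff ⌊δq * (m : ℚ)⌋₊))
        (Filter.atTop ⊓ Filter.principal Mset) (nhds W) := by
  have hAnn' : ∀ t u, 0 ≤ A t u := by
    intro t u
    by_cases h0 : u = 0
    · rw [h0, hA0]; norm_num
    · by_cases h1 : u < rd t ∨ s t < u
      · rw [hAsupp t u h0 h1]
      · push Not at h1
        exact hAnn t u h1.1 h1.2
  have hcoeff : ∀ t u, (Ap t).coeff u = A t u := by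
    intro t u
    rw [hAp, finsetSum_coeff]
    simp only [coeff_C_mul, coeff_X_pow, mul_ite, mul_one, mul_zero, Finset.sum_ite_eq,
      Finset.mem_range]
    split_ifs with h
    · rfl
    · exact (hAsupp t u (by omega) (Or.inr (by omega))).symm
  have hNN : ∀ t, GR.NN (Ap t) := fun t u => by rw [hcoeff]; exact hAnn' t u
  have hc0 : ∀ t, (Ap t).coeff 0 = 1 := fun t => by rw [hcoeff, hA0]
  have hU : ∀ t, (Finset.range (s t + 1)).filter (fun i => 0 < A t i) = (Ap t).support := by
    intro t
    ext u
    rw [Finset.mem_filter, mem_support_iff, hcoeff, Finset.mem_range]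
    constructor
    · rintro ⟨_, h⟩; exact h.ne'
    · intro h
      refine ⟨?_, lt_of_le_of_ne (hAnn' t u) (Ne.symm h)⟩
      by_contra hu
      exact h (hAsupp t u (by omega) (Or.inr (by omega)))
  have hne : ∀ t, Ap t ≠ 0 := fun t h => by have := hc0 t; rw [h] at this; simp at this
  have hdeg : ∀ t, 0 < (Ap t).natDegree := by
    intro t
    have : rd t ≤ (Ap t).natDegree := le_natDegree_of_ne_zero (by rw [hcoeff]; exact (hAr t).ne')
    have := h_rd2 t
    omega
  have herase : ∀ t (β : ℕ → ℝ), ∑ i ∈ (Ap t).support.erase 0, (i : ℝ) * β i =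
      ∑ i ∈ (Ap t).support, (i : ℝ) * β i := fun t β => Finset.sum_erase _ (by simp)
  simp only [hU]
  simp only [herase, ← hcoeff]
  set N : ℕ → Fin nc → ℕ := fun m t => ⌊γ t * (m : ℝ)⌋₊ with hN
  set D : ℕ → ℕ := fun m => ⌊δq * (m : ℚ)⌋₊ with hD
  set F : ℕ → ℝ[X] := fun m => ∏ t, Ap t ^ N m t with hF
  have hM : ∀ m, m ∈ Mset ↔ 0 < m ∧ (∀ t, (N m t : ℝ) = γ t * m) ∧ (D m : ℚ) = δq * m ∧
      0 < (F m).coeff (D m) := by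
    intro m; rw [hMset]; rfl
  have hFNN : ∀ m, GR.NN (F m) := fun m => GR.NN.prod _ _ fun t => (hNN t).pow _
  have hδ : (0 : ℝ) < δq := by exact_mod_cast hδq
  have hDR : ∀ m ∈ Mset, (D m : ℝ) = δq * m := by
    intro m hm
    have := ((hM m).1 hm).2.2.1
    exact_mod_cast congrArg (fun q : ℚ => (q : ℝ)) this
  -- evaluation
  have hlogF : ∀ m ∈ Mset, ∀ y : ℝ, 0 < y →
      Real.log ((F m).eval y) = m * ∑ t, γ t * Real.log ((Ap t).eval y) := by
    intro m hm y hy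
    simp only [hF]
    rw [eval_prod, Real.log_prod (fun t _ => by
      rw [eval_pow]; exact (pow_pos (GR.eval_pos' (hNN t) (hc0 t) hy.le) _).ne'), Finset.mul_sum]
    refine Finset.sum_congr rfl fun t _ => ?_
    rw [eval_pow, Real.log_pow, ((hM m).1 hm).2.1 t]
    ring
  have hubG : ∀ m ∈ Mset, ∀ y : ℝ, 0 < y → Real.log ((F m).coeff (D m)) ≤
      m * (∑ t, γ t * Real.log ((Ap t).eval y) - δq * Real.log y) := by
    intro m hm y hy
    have hc := ((hM m).1 hm).2.2.2
    have h1 := Real.log_le_log (by positivity) (GR.coeff_le_eval (hFNN m) (D m) hy)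
    rw [hlogF m hm y hy, Real.log_mul hc.ne' (by positivity), Real.log_pow, hDR m hm] at h1
    linarith
  -- additivity
  have hadd : ∀ m ∈ Mset, ∀ n ∈ Mset, m + n ∈ Mset ∧
      Real.log ((F m).coeff (D m)) + Real.log ((F n).coeff (D n)) ≤
        Real.log ((F (m + n)).coeff (D (m + n))) := by
    intro m hm n hn
    obtain ⟨m0, mN, mD, mc⟩ := (hM m).1 hm
    obtain ⟨n0, nN, nD, ncc⟩ := (hM n).1 hn
    have eN : ∀ t, N (m + n) t = N m t + N n t := by
      intro t
      have : γ t * ((m + n : ℕ) : ℝ) = ((N m t + N n t : ℕ) : ℝ) := by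
        push_cast; rw [mN, nN]; ring
      show ⌊γ t * ((m + n : ℕ) : ℝ)⌋₊ = _
      rw [this, Nat.floor_natCast]
    have eD : D (m + n) = D m + D n := by
      have : δq * ((m + n : ℕ) : ℚ) = ((D m + D n : ℕ) : ℚ) := by
        push_cast; rw [mD, nD]; ring
      show ⌊δq * ((m + n : ℕ) : ℚ)⌋₊ = _
      rw [this, Nat.floor_natCast]
    have eF : F (m + n) = F m * F n := by
      simp only [hF]
      rw [← Finset.prod_mul_distrib]
      exact Finset.prod_congr rfl fun t _ => by rw [eN, pow_add]
    have hge := GR.coeff_mul_ge (hFNN m) (hFNN n) (D m) (D n)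
    rw [← eF, ← eD] at hge
    have hpos : 0 < (F m).coeff (D m) * (F n).coeff (D n) := mul_pos mc ncc
    refine ⟨(hM _).2 ⟨by omega, ?_, ?_, hpos.trans_le hge⟩, ?_⟩
    · intro t; rw [eN]; push_cast; rw [mN, nN]; ring
    · rw [eD]; push_cast; rw [mD, nD]; ring
    · rw [← Real.log_mul mc.ne' ncc.ne']
      exact Real.log_le_log hpos hge
  have hmul : ∀ m ∈ Mset, ∀ k : ℕ, F (k * m) = F m ^ k ∧ D (k * m) = k * D m ∧
      (0 < k → k * m ∈ Mset) := by
    intro m hm k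
    obtain ⟨m0, mN, mD, mc⟩ := (hM m).1 hm
    have eN : ∀ t, N (k * m) t = k * N m t := by
      intro t
      have : γ t * ((k * m : ℕ) : ℝ) = ((k * N m t : ℕ) : ℝ) := by
        push_cast; rw [mN]; ring
      show ⌊γ t * ((k * m : ℕ) : ℝ)⌋₊ = _
      rw [this, Nat.floor_natCast]
    have eD : D (k * m) = k * D m := by
      have : δq * ((k * m : ℕ) : ℚ) = ((k * D m : ℕ) : ℚ) := by
        push_cast; rw [mD]; ring
      show ⌊δq * ((k * m : ℕ) : ℚ)⌋₊ = _
      rw [this, Nat.floor_natCast]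
    have eF : F (k * m) = F m ^ k := by
      simp only [hF]
      rw [← Finset.prod_pow]
      exact Finset.prod_congr rfl fun t _ => by rw [eN, mul_comm, pow_mul]
    refine ⟨eF, eD, fun hk => (hM _).2 ⟨Nat.mul_pos hk m0, ?_, ?_, ?_⟩⟩
    · intro t; rw [eN]; push_cast; rw [mN]; ring
    · rw [eD]; push_cast; rw [mD]; ring
    · rw [eF, eD, mul_comm]
      exact (pow_pos mc k).trans_le (GR.coeff_pow_ge (hFNN m) _ _)
  -- upper bound on the set
  have hsetG : ∀ (ev : Fin nc → ℝ) (β : Fin nc → ℕ → ℝ), (∑ t, ev t = (δq : ℝ)) →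
      (∀ t i, 0 ≤ β t i) → (∀ t, ∑ i ∈ (Ap t).support, β t i = 1) →
      (∀ t, ∑ i ∈ (Ap t).support, (i : ℝ) * β t i = ev t / γ t) → ∀ y : ℝ, 0 < y →
      ∑ t, γ t * ∑ i ∈ (Ap t).support, β t i * Real.log ((Ap t).coeff i / β t i) ≤
        ∑ t, γ t * Real.log ((Ap t).eval y) - δq * Real.log y := by
    intro ev β hev hβ hs hm y hy
    have : ∀ t ∈ Finset.univ, γ t * ∑ i ∈ (Ap t).support, β t i *
        Real.log ((Ap t).coeff i / β t i) ≤
        γ t * Real.log ((Ap t).eval y) - ev t * Real.log y := by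
      intro t _
      have h1 := mul_le_mul_of_nonneg_left
        (GR.gibbs (hNN t) (hc0 t) (β t) (hβ t) (hs t) hy) (hγ t).le
      rw [hm t, mul_sub, ← mul_assoc, mul_div_cancel₀ _ (hγ t).ne'] at h1
      exact h1
    refine (Finset.sum_le_sum this).trans (le_of_eq ?_)
    rw [Finset.sum_sub_distrib, ← Finset.sum_mul, hev]
  obtain ⟨m0, hm0⟩ := hMinf.nonempty
  obtain ⟨m0pos, m0N, m0D, m0c⟩ := (hM m0).1 hm0
  have m0R : (0 : ℝ) < m0 := by exact_mod_cast m0pos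
  have hFdeg : ∀ m ∈ Mset, ((F m).natDegree : ℝ) = m * ∑ t, γ t * (Ap t).natDegree := by
    intro m hm
    simp only [hF]
    rw [natDegree_prod _ _ fun t _ => pow_ne_zero _ (hne t)]
    push_cast
    rw [Finset.mul_sum]
    refine Finset.sum_congr rfl fun t _ => ?_
    rw [natDegree_pow]; push_cast; rw [((hM m).1 hm).2.1 t]; ring
  have hδle : (δq : ℝ) ≤ ∑ t, γ t * (Ap t).natDegree := by
    have h1 : D m0 ≤ (F m0).natDegree := le_natDegree_of_ne_zero m0c.ne'
    have h2 : (D m0 : ℝ) ≤ (F m0).natDegree := by exact_mod_cast h1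
    rw [hDR m0 hm0, hFdeg m0 hm0, mul_comm] at h2
    exact le_of_mul_le_mul_left h2 m0R
  rcases hδle.lt_or_eq with hlt | heq
  · -- interior case
    obtain ⟨x, hx, hfx⟩ : ∃ x : ℝ, 0 < x ∧
        ∑ t, γ t * ((X * derivative (Ap t)).eval x / (Ap t).eval x) = δq := by
      have hlim : Tendsto (fun x : ℝ => ∑ t, γ t *
          ((X * derivative (Ap t)).eval x / (Ap t).eval x)) atTop
          (nhds (∑ t, γ t * ((Ap t).natDegree : ℝ))) :=
        tendsto_finsetSum _ fun t _ => (GR.nat_deg_facts (hdeg t)).const_mul _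
      obtain ⟨b, hb, hb0⟩ :=
        ((hlim.eventually (lt_mem_nhds hlt)).and (eventually_gt_atTop 0)).exists
      have hcont : ContinuousOn (fun x : ℝ => ∑ t, γ t *
          ((X * derivative (Ap t)).eval x / (Ap t).eval x)) (Set.Icc 0 b) := by
        refine continuousOn_finsetSum _ fun t _ => continuousOn_const.mul ?_
        exact (Polynomial.continuous _).continuousOn.div (Polynomial.continuous _).continuousOn
          fun x hx => (GR.eval_pos' (hNN t) (hc0 t) hx.1).ne'
      have hmem : (δq : ℝ) ∈ Set.Icc
          ((fun x : ℝ => ∑ t, γ t * ((X * derivative (Ap t)).eval x / (Ap t).eval x)) 0)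
          ((fun x : ℝ => ∑ t, γ t * ((X * derivative (Ap t)).eval x / (Ap t).eval x)) b) :=
        ⟨by simpa using hδ.le, hb.le⟩
      obtain ⟨x, hx, hfx⟩ := intermediate_value_Icc hb0.le hcont hmem
      refine ⟨x, lt_of_le_of_ne hx.1 ?_, hfx⟩
      rintro rfl
      simp at hfx
      exact hδ.ne hfx
    set W := ∑ t, γ t * Real.log ((Ap t).eval x) - δq * Real.log x with hW
    have hZ : ∀ t, 0 < (Ap t).eval x := fun t => GR.eval_pos' (hNN t) (hc0 t) hx.le
    have hβ0 : ∀ t i, 0 ≤ (Ap t).coeff i * x ^ i / (Ap t).eval x := fun t i =>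
      div_nonneg (mul_nonneg (hNN t i) (by positivity)) (hZ t).le
    have hval : W = ∑ t, γ t * ∑ i ∈ (Ap t).support, ((Ap t).coeff i * x ^ i / (Ap t).eval x) *
        Real.log ((Ap t).coeff i / ((Ap t).coeff i * x ^ i / (Ap t).eval x)) := by
      rw [hW, ← hfx, Finset.sum_mul, ← Finset.sum_sub_distrib]
      refine Finset.sum_congr rfl fun t _ => ?_
      rw [GR.gibbs_eq (hNN t) (hc0 t) hx]
      ring
    have hmean : ∀ t, ∑ i ∈ (Ap t).support, (i : ℝ) * ((Ap t).coeff i * x ^ i / (Ap t).eval x) =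
        (γ t * ((X * derivative (Ap t)).eval x / (Ap t).eval x)) / γ t := by
      intro t
      rw [GR.gibbs_mean, mul_div_cancel_left₀ _ (hγ t).ne']
    have hWG : ∀ y : ℝ, 0 < y → W ≤ ∑ t, γ t * Real.log ((Ap t).eval y) - δq * Real.log y := by
      intro y hy
      rw [hval]
      exact hsetG _ (fun t i => (Ap t).coeff i * x ^ i / (Ap t).eval x) hfx hβ0
        (fun t => GR.gibbs_sum (hNN t) (hc0 t) hx) hmean y hy
    refine ⟨W, ⟨⟨_, fun t i => (Ap t).coeff i * x ^ i / (Ap t).eval x, ?_, hfx, hβ0,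
      (fun t => GR.gibbs_sum (hNN t) (hc0 t) hx), hmean, hval⟩, ?_⟩, ?_⟩
    · intro t
      have h1 : 0 ≤ ∑ i ∈ (Ap t).support, (i : ℝ) * ((Ap t).coeff i * x ^ i / (Ap t).eval x) :=
        Finset.sum_nonneg fun i _ => mul_nonneg (Nat.cast_nonneg _) (hβ0 t i)
      rw [GR.gibbs_mean] at h1
      exact mul_nonneg (hγ t).le h1
    · rintro w ⟨ev, β, -, hev, hβ, hs, hm, rfl⟩
      exact hsetG ev β hev hβ hs hm x hx
    · refine GR.fekete Mset (fun m => Real.log ((F m).coeff (D m))) W hadd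
        (fun m hm => ((hM m).1 hm).1) (fun m hm => hubG m hm x hx) ?_
      intro ε hε
      by_contra! hcon
      have hD0 : 0 < D m0 := by
        have : (0 : ℝ) < D m0 := by rw [hDR m0 hm0]; positivity
        exact_mod_cast this
      have hDlt : D m0 < (F m0).natDegree := by
        have : (D m0 : ℝ) < (F m0).natDegree := by
          rw [hDR m0 hm0, hFdeg m0 hm0, mul_comm]
          exact mul_lt_mul_of_pos_left hlt m0R
        exact_mod_cast this
      have hF0 : 0 < (F m0).coeff 0 := by
        rw [coeff_zero_eq_eval_zero]
        simp only [hF]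
        rw [eval_prod]
        refine Finset.prod_pos fun t _ => ?_
        rw [eval_pow]
        exact pow_pos (GR.eval_pos' (hNN t) (hc0 t) le_rfl) _
      have hFne : F m0 ≠ 0 := by intro h; rw [h] at hF0; simp at hF0
      have hFl : 0 < (F m0).coeff (F m0).natDegree :=
        lt_of_le_of_ne (hFNN m0 _) (Ne.symm (leadingCoeff_ne_zero.2 hFne))
      obtain ⟨z, hz⟩ := GR.key (hFNN m0) (D m0) 0 _ hD0 hDlt hF0 hFl (m0 * (W - ε)) (by
        intro k
        rcases Nat.eq_zero_or_pos k with rfl | hk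
        · simp
        · obtain ⟨e1, e2, e3⟩ := hmul m0 hm0 k
          have hk' := e3 hk
          have h1 := hcon _ hk'
          have hc := ((hM _).1 hk').2.2.2
          rw [← e1, ← e2]
          rw [← Real.log_le_iff_le_exp hc]
          refine h1.le.trans (le_of_eq ?_)
          push_cast; ring)
      have hy : 0 < Real.exp (-z) := Real.exp_pos _
      have hFy : 0 < (F m0).eval (Real.exp (-z)) :=
        lt_of_lt_of_le (by positivity) (GR.coeff_le_eval (hFNN m0) (D m0) hy)
      have h2 := Real.log_le_log hFy hz
      rw [hlogF m0 hm0 _ hy, Real.log_exp, hDR m0 hm0] at h2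
      have h3 := hWG _ hy
      rw [Real.log_exp] at h3
      have h4 := mul_le_mul_of_nonneg_left h3 m0R.le
      have h5 : 0 < (m0 : ℝ) * ε := by positivity
      linarith
  · -- boundary case
    have hlead : ∀ t, 0 < (Ap t).leadingCoeff := fun t =>
      lt_of_le_of_ne (hNN t _) (Ne.symm (leadingCoeff_ne_zero.2 (hne t)))
    have hmemD : ∀ t, (Ap t).natDegree ∈ (Ap t).support := fun t =>
      natDegree_mem_support_of_nonzero (hne t)
    refine ⟨∑ t, γ t * Real.log (Ap t).leadingCoeff, ⟨⟨fun t => γ t * (Ap t).natDegree,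
      fun t i => if i = (Ap t).natDegree then 1 else 0, ?_, heq.symm, ?_, ?_, ?_, ?_⟩, ?_⟩, ?_⟩
    · intro t; have := (hγ t).le; positivity
    · intro t i; dsimp only; split_ifs <;> norm_num
    · intro t; rw [Finset.sum_ite_eq', if_pos (hmemD t)]
    · intro t
      simp only [mul_ite, mul_one, mul_zero]
      rw [Finset.sum_ite_eq', if_pos (hmemD t), mul_div_cancel_left₀ _ (hγ t).ne']
    · refine Finset.sum_congr rfl fun t _ => ?_
      congr 1
      rw [Finset.sum_eq_single_of_mem _ (hmemD t) (fun i _ hi => by simp [hi])]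
      simp
    · rintro w ⟨ev, β, -, hev, hβ, hs, hm, rfl⟩
      have hlim : Tendsto (fun y : ℝ => ∑ t, γ t *
          (Real.log ((Ap t).eval y) - (Ap t).natDegree * Real.log y)) atTop
          (nhds (∑ t, γ t * Real.log (Ap t).leadingCoeff)) :=
        tendsto_finsetSum _ fun t _ => (GR.log_lead (hNN t) (hc0 t)).const_mul _
      refine ge_of_tendsto hlim ?_
      filter_upwards [eventually_gt_atTop 0] with y hy
      refine (hsetG ev β hev hβ hs hm y hy).trans (le_of_eq ?_)
      rw [heq, Finset.sum_mul, ← Finset.sum_sub_distrib]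
      exact Finset.sum_congr rfl fun t _ => by ring
    · refine tendsto_const_nhds.congr' ?_
      rw [EventuallyEq, eventually_inf_principal]
      refine Eventually.of_forall fun m hm => ?_
      have hmR : (0 : ℝ) < m := by exact_mod_cast ((hM m).1 hm).1
      have hDm : D m = (F m).natDegree := by
        have : (D m : ℝ) = (F m).natDegree := by
          rw [hDR m hm, hFdeg m hm, heq, mul_comm]
        exact_mod_cast this
      have hl : (F m).coeff (D m) = ∏ t, (Ap t).leadingCoeff ^ N m t := by
        rw [hDm, coeff_natDegree]
        simp only [hF]
        rw [leadingCoeff_prod]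
        exact Finset.prod_congr rfl fun t _ => leadingCoeff_pow _ _
      show _ = 1 / (m : ℝ) * Real.log ((F m).coeff (D m))
      rw [hl, Real.log_prod (fun t _ => (pow_pos (hlead t) _).ne'), Finset.mul_sum]
      refine Finset.sum_congr rfl fun t _ => ?_
      rw [Real.log_pow, ((hM m).1 hm).2.1 t]
      field_simp
end

section
/- Closed form for the check-node optimization value. Let I_c be a nonempty finite set; for each t in I_c let A^{(t)}(x) = 1 + sum_{u=r_t}^{s_t} A_u^{(t)} x^u with integers 2 <= r_t <= s_t, A_u^{(t)} >= 0, A_{r_t}^{(t)} > 0, and let gamma_t > 0 with sum_{t in I_c} gamma_t = 1; set A_0^{(t)} = 1, U_t = { i : A_i^{(t)} > 0 }, U_t^- = U_t \ {0}. Define r = min_t r_t, X_c = {t : r_t = r}, C' = r sum_{t in X_c} A_r^{(t)} gamma_t > 0, and rbar = min{ i > r : A_i^{(t)} > 0 for some t in I_c }. For delta > 0 let W(delta) = max over (eps_t) with eps_t >= 0, sum_t eps_t = delta, of sum_{t in I_c} gamma_t max over beta^{(t)} with beta_i^{(t)} >= 0, sum_{i in U_t} beta_i^{(t)} = 1, sum_{i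 in U_t^-} i beta_i^{(t)} = eps_t/gamma_t, of sum_{i in U_t} beta_i^{(t)} log( A_i^{(t)} / beta_i^{(t)} ). Then W(delta) = (delta/r) log( e C' / delta ) + O( delta^{min{rbar/r, 2}} ) as delta -> 0+, i.e., there exist k, eps > 0 such that | W(delta) - (delta/r) log( e C' / delta ) | <= k delta^{min{rbar/r, 2}} for all 0 < delta <= eps. -/
open Finset
open scoped Classical

lemma aux_term (a b : ℝ) (ha : 0 < a) (hb : 0 ≤ b) : b * Real.log (a / b) ≤ a - b := by
  rcases hb.eq_or_lt with h | h
  · subst h; simp; exact ha.le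
  · have h1 := Real.log_le_sub_one_of_pos (div_pos ha h)
    have h2 := mul_le_mul_of_nonneg_left h1 h.le
    have h3 : b * (a / b - 1) = a - b := by field_simp
    linarith

lemma aux_term2 (A b x : ℝ) (i : ℕ) (hA : 0 < A) (hb : 0 ≤ b) (hx : 0 < x) :
    b * Real.log (A / b) ≤ A * x ^ i - b - Real.log x * (i * b) := by
  have h := aux_term (A * x ^ i) b (by positivity) hb
  rcases hb.eq_or_lt with h0 | h0
  · subst h0; simpa using h
  · have : Real.log (A * x ^ i / b) = Real.log (A / b) + i * Real.log x := by
      rw [mul_div_right_comm, Real.log_mul (by positivity) (by positivity), Real.log_pow]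
    rw [this] at h
    linarith [mul_add b (Real.log (A / b)) (i * Real.log x), mul_comm (Real.log x) (i * b),
      mul_assoc b (i : ℝ) (Real.log x), mul_comm b (i : ℝ)]

lemma aux_gibbs (U : Finset ℕ) (h0 : 0 ∈ U) (A β : ℕ → ℝ) (hA0 : A 0 = 1)
    (hA : ∀ i ∈ U, 0 < A i) (hβ : ∀ i, 0 ≤ β i) (h1 : ∑ i ∈ U, β i = 1) (x : ℝ) (hx : 0 < x) :
    ∑ i ∈ U, β i * Real.log (A i / β i) ≤
      ∑ i ∈ U.erase 0, A i * x ^ i - Real.log x * ∑ i ∈ U.erase 0, (i : ℝ) * β i := by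
  have h := Finset.sum_le_sum (fun i hi => aux_term2 (A i) (β i) x i (hA i hi) (hβ i) hx)
  rw [Finset.sum_sub_distrib, Finset.sum_sub_distrib, h1, ← Finset.mul_sum,
    ← Finset.add_sum_erase U (fun i => A i * x ^ i) h0,
    ← Finset.add_sum_erase U (fun i => (i : ℝ) * β i) h0] at h
  simp only [hA0, pow_zero, Nat.cast_zero, zero_mul, zero_add] at h
  linarith

lemma aux_low (b : ℝ) (hb : b ≤ 1) : b - b ^ 2 ≤ (1 - b) * Real.log (1 / (1 - b)) := by
  rcases hb.eq_or_lt with h | h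
  · subst h; simp
  · have h1 : 0 < 1 - b := by linarith
    have h2 := Real.log_le_sub_one_of_pos h1
    rw [one_div, Real.log_inv]
    nlinarith

lemma aux_compact (nc : ℕ) (U : Fin nc → Finset ℕ) (A : Fin nc → ℕ → ℝ) 
    (hA : ∀ t, ∀ i ∈ U t, 0 < A t i) (γ : Fin nc → ℝ) (hγ : ∀ t, 0 < γ t) (δ : ℝ)
    (hne : {x : ℝ | ∃ (ev : Fin nc → ℝ) (β : Fin nc → ℕ → ℝ),
            (∀ t, 0 ≤ ev t) ∧ (∑ t, ev t = δ) ∧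
            (∀ t i, 0 ≤ β t i) ∧
            (∀ t, ∑ i ∈ U t, β t i = 1) ∧
            (∀ t, ∑ i ∈ (U t).erase 0,
              (i : ℝ) * β t i = ev t / γ t) ∧
            x = ∑ t, γ t * ∑ i ∈ U t, β t i * Real.log (A t i / β t i)}.Nonempty) :
    ∃ W, IsGreatest {x : ℝ | ∃ (ev : Fin nc → ℝ) (β : Fin nc → ℕ → ℝ),
            (∀ t, 0 ≤ ev t) ∧ (∑ t, ev t = δ) ∧
            (∀ t i, 0 ≤ β t i) ∧
            (∀ t, ∑ i ∈ U t, β t i = 1) ∧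
            (∀ t, ∑ i ∈ (U t).erase 0,
              (i : ℝ) * β t i = ev t / γ t) ∧
            x = ∑ t, γ t * ∑ i ∈ U t, β t i * Real.log (A t i / β t i)} W := by
  set F : (Fin nc → ℕ → ℝ) → ℝ := fun β => ∑ t, γ t * ∑ i ∈ U t, 
    (β t i * Real.log (A t i) + Real.negMulLog (β t i)) with hF
  have hFeq : ∀ β : Fin nc → ℕ → ℝ, ∑ t, γ t * ∑ i ∈ U t, β t i * Real.log (A t i / β t i) = F β := by
    intro β
    refine Finset.sum_congr rfl fun t _ => ?_
    congr 1
    refine Finset.sum_congr rfl fun i hi => ?_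
    by_cases h : β t i = 0
    · simp [h]
    · rw [Real.log_div (hA t i hi).ne' h, Real.negMulLog]; ring
  have hFc : Continuous F := by
    have := Real.continuous_negMulLog
    fun_prop
  set K : Set (Fin nc → ℕ → ℝ) := Set.univ.pi (fun _ => Set.univ.pi fun _ => Set.Icc (0:ℝ) 1) with hK
  have hKc : IsCompact K :=
    isCompact_univ_pi fun _ => isCompact_univ_pi fun _ => isCompact_Icc
  set S : Set (Fin nc → ℕ → ℝ) := {β | (∀ t, ∑ i ∈ U t, β t i = 1) ∧
    ∑ t, γ t * ∑ i ∈ (U t).erase 0, (i : ℝ) * β t i = δ} with hS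
  have hSc : IsClosed S := by
    rw [hS, Set.ofPred_and]
    refine IsClosed.inter ?_ ?_
    · rw [Set.ofPred_forall]
      refine isClosed_iInter fun t => isClosed_eq (by fun_prop) continuous_const
    · exact isClosed_eq (by fun_prop) continuous_const
  have hset : {x : ℝ | ∃ (ev : Fin nc → ℝ) (β : Fin nc → ℕ → ℝ),
            (∀ t, 0 ≤ ev t) ∧ (∑ t, ev t = δ) ∧
            (∀ t i, 0 ≤ β t i) ∧
            (∀ t, ∑ i ∈ U t, β t i = 1) ∧
            (∀ t, ∑ i ∈ (U t).erase 0,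
              (i : ℝ) * β t i = ev t / γ t) ∧
            x = ∑ t, γ t * ∑ i ∈ U t, β t i * Real.log (A t i / β t i)} = F '' (K ∩ S) := by
    ext x
    constructor
    · rintro ⟨ev, β, h1, h2, h3, h4, h5, rfl⟩
      have hle : ∀ t, ∀ i ∈ U t, β t i ≤ 1 := fun t i hi => by
        rw [← h4 t]; exact Finset.single_le_sum (fun j _ => h3 t j) hi
      have hmin : ∀ t, ∀ i ∈ U t, min (β t i) 1 = β t i := fun t i hi => min_eq_left (hle t i hi)
      refine ⟨fun t i => min (β t i) 1, ⟨?_, ?_, ?_⟩, ?_⟩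
      · intro t _ i _
        exact ⟨le_min (h3 t i) zero_le_one, min_le_right _ _⟩
      · intro t
        exact (Finset.sum_congr rfl (hmin t)).trans (h4 t)
      · rw [← h2]
        refine Finset.sum_congr rfl fun t _ => ?_
        have : ∑ i ∈ (U t).erase 0, (i : ℝ) * min (β t i) 1 = ev t / γ t := by
          rw [← h5 t]
          refine Finset.sum_congr rfl fun i hi => ?_
          rw [hmin t i (Finset.mem_of_mem_erase hi)]
        rw [this]
        have := (hγ t).ne'
        field_simp
      · rw [hFeq]
        refine Finset.sum_congr rfl fun t _ => ?_
        congr 1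
        refine Finset.sum_congr rfl fun i hi => ?_
        simp only [hmin t i hi]
    · rintro ⟨β, ⟨h1, h2, h3⟩, rfl⟩
      have h0 : ∀ t i, 0 ≤ β t i := fun t i => (h1 t trivial i trivial).1
      refine ⟨fun t => γ t * ∑ i ∈ (U t).erase 0, (i : ℝ) * β t i, β, ?_, h3, h0, h2, ?_, (hFeq β).symm⟩
      · intro t
        exact mul_nonneg (hγ t).le (Finset.sum_nonneg fun i _ => mul_nonneg (Nat.cast_nonneg i) (h0 t i))
      · intro t
        have := (hγ t).ne'
        field_simp
  rw [hset] at hne ⊢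
  exact ((hKc.inter_right hSc).image hFc).exists_isGreatest hne

/-- **Closed form for the check-node optimization value.**
With check-node weight enumerator coefficients `A^{(t)}` and fractions `γ_t`, let
`r = min_t r_t`, `C' = r ∑_{t: r_t = r} A_r^{(t)} γ_t` and `r̄` the second smallest
minimum distance.  Then the optimization value `W(δ)` satisfies
`W(δ) = (δ/r) log(e C'/δ) + O(δ^{min{r̄/r, 2}})` as `δ → 0⁺`.  The exponent
`min{r̄/r, 2}` is encoded as the infimum of `{2} ∪ {i/r : i > r, A_i^{(t)} > 0 some t}`
(so it is `2` when no such `i` exists), and `W(δ)` is characterized as the greatest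
value of the jointly encoded nested maximization. -/
theorem check_node_optimization_closed_form (nc : ℕ) (hnc : 0 < nc)
    (s rd : Fin nc → ℕ) (A : Fin nc → ℕ → ℝ)
    (h_rd2 : ∀ t, 2 ≤ rd t) (h_rds : ∀ t, rd t ≤ s t)
    (hA0 : ∀ t, A t 0 = 1) (hAr : ∀ t, 0 < A t (rd t))
    (hAnn : ∀ t u, rd t ≤ u → u ≤ s t → 0 ≤ A t u)
    (hAsupp : ∀ t u, u ≠ 0 → u < rd t ∨ s t < u → A t u = 0)
    (γ : Fin nc → ℝ) (hγ : ∀ t, 0 < γ t) (hγ1 : ∑ t, γ t = 1)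
    (r : ℕ) (hr : r = sInf (Set.range rd))
    (C' : ℝ) (hC' : C' = (r : ℝ) * ∑ t ∈ Finset.univ.filter (fun t => rd t = r),
      A t r * γ t)
    (expo : ℝ)
    (hexpo : expo = sInf ({2} ∪
      {x : ℝ | ∃ i : ℕ, r < i ∧ (∃ t, 0 < A t i) ∧ x = (i : ℝ) / (r : ℝ)})) :
    ∃ k : ℝ, 0 < k ∧ ∃ ε : ℝ, 0 < ε ∧
      ∀ δ : ℝ, 0 < δ → δ ≤ ε →
        ∃ W : ℝ,
          IsGreatest {x : ℝ | ∃ (ev : Fin nc → ℝ) (β : Fin nc → ℕ → ℝ),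
            (∀ t, 0 ≤ ev t) ∧ (∑ t, ev t = δ) ∧
            (∀ t i, 0 ≤ β t i) ∧
            (∀ t, ∑ i ∈ (Finset.range (s t + 1)).filter (fun i => 0 < A t i), β t i = 1) ∧
            (∀ t, ∑ i ∈ ((Finset.range (s t + 1)).filter (fun i => 0 < A t i)).erase 0,
              (i : ℝ) * β t i = ev t / γ t) ∧
            x = ∑ t, γ t * ∑ i ∈ (Finset.range (s t + 1)).filter (fun i => 0 < A t i),
              β t i * Real.log (A t i / β t i)} W ∧
          |W - (δ / (r : ℝ)) * Real.log (Real.exp 1 * C' / δ)| ≤ k * δ ^ expo := by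
  have hrange : (Set.range rd).Nonempty := ⟨_, ⟨⟨0, hnc⟩, rfl⟩⟩
  obtain ⟨t0, ht0⟩ : ∃ t, rd t = r := by
    have := Nat.sInf_mem hrange
    rw [← hr] at this; exact this
  have hrle : ∀ t, r ≤ rd t := fun t => by rw [hr]; exact Nat.sInf_le ⟨t, rfl⟩
  have hr2 : 2 ≤ r := ht0 ▸ h_rd2 t0
  have hr0 : (0:ℝ) < r := by exact_mod_cast (by omega : 0 < r)
  have hAnn' : ∀ t u, 0 ≤ A t u := by
    intro t u
    by_cases h0 : u = 0
    · subst h0; rw [hA0]; exact zero_le_one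
    by_cases h : u < rd t ∨ s t < u
    · exact (hAsupp t u h0 h).ge
    · push Not at h; exact hAnn t u h.1 h.2
  have hC1 : C' = r * ∑ t, A t r * γ t := by
    rw [hC']
    congr 1
    apply Finset.sum_subset (Finset.subset_univ _)
    intro t _ ht
    have : rd t ≠ r := by simpa using ht
    rw [hAsupp t r (by omega) (Or.inl (lt_of_le_of_ne (hrle t) this.symm)), zero_mul]
  have hCpos : 0 < C' := by
    rw [hC1]
    refine mul_pos hr0 (Finset.sum_pos' (fun t _ => mul_nonneg (hAnn' t r) (hγ t).le) ⟨t0, Finset.mem_univ _, ?_⟩)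
    have := hAr t0
    rw [ht0] at this
    exact mul_pos this (hγ t0)
  have hCsum : ∑ t, A t r * γ t = C' / r := by rw [hC1]; field_simp
  -- exponent facts
  have hbdd : BddBelow ({2} ∪
      {x : ℝ | ∃ i : ℕ, r < i ∧ (∃ t, 0 < A t i) ∧ x = (i : ℝ) / (r : ℝ)}) := by
    refine ⟨0, ?_⟩
    rintro x (hx | ⟨i, -, -, rfl⟩)
    · rw [Set.mem_singleton_iff.1 hx]; norm_num
    · positivity
  have he2 : expo ≤ 2 := by rw [hexpo]; exact csInf_le hbdd (Or.inl rfl)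
  have hei : ∀ t i, r < i → 0 < A t i → expo ≤ (i:ℝ) / r := fun t i h1 h2 => by
    rw [hexpo]; exact csInf_le hbdd (Or.inr ⟨i, h1, ⟨t, h2⟩, rfl⟩)
  clear hexpo hbdd hr hC'
  set U : Fin nc → Finset ℕ := fun t => (Finset.range (s t + 1)).filter (fun i => 0 < A t i) with hU
  have hUA : ∀ t, ∀ i ∈ U t, 0 < A t i := fun t i hi => (Finset.mem_filter.1 hi).2
  have hU0 : ∀ t, 0 ∈ U t := fun t => by simp [hU, hA0]
  have hUr : ∀ t i, i ∈ (U t).erase 0 → r ≤ i := by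
    intro t i hi
    have h0 := Finset.ne_of_mem_erase hi
    have h1 := hUA t i (Finset.mem_of_mem_erase hi)
    by_contra h
    have := hAsupp t i h0 (Or.inl (by have := hrle t; omega))
    linarith
  have hrU : ∀ t, r ∉ (U t).erase 0 → A t r = 0 := by
    intro t h
    by_contra h1
    have h2 : 0 < A t r := lt_of_le_of_ne (hAnn' t r) (Ne.symm h1)
    have h3 : ¬ (r < rd t ∨ s t < r) := fun h => h1 (hAsupp t r (by omega) h)
    push Not at h3
    apply h
    simp only [hU, Finset.mem_erase, Finset.mem_filter, Finset.mem_range]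
    exact ⟨by omega, by omega, h2⟩
  set k1 : ℝ := ∑ t, γ t * ∑ i ∈ (U t).erase 0, A t i * (1 / C') ^ ((i:ℝ) / r) with hk1
  set k2 : ℝ := ∑ t, γ t * (A t r / C') ^ 2 with hk2
  have hk1n : 0 ≤ k1 := Finset.sum_nonneg fun t _ => mul_nonneg (hγ t).le
    (Finset.sum_nonneg fun i _ => mul_nonneg (hAnn' t i) (by positivity))
  have hk2n : 0 ≤ k2 := Finset.sum_nonneg fun t _ => mul_nonneg (hγ t).le (by positivity)
  set M : ℝ := 1 + ∑ t, A t r with hM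
  have hMA : ∀ t, A t r ≤ M := fun t => by
    have := Finset.single_le_sum (f := fun t => A t r) (fun t _ => hAnn' t r) (Finset.mem_univ t)
    linarith
  have hMpos : 0 < M := by
    have := Finset.sum_nonneg (fun t (_ : t ∈ Finset.univ) => hAnn' t r)
    linarith
  refine ⟨k1 + k2 + 1, by linarith, min 1 (C' / M), by positivity, ?_⟩
  intro δ hδ hδε
  have hδ1 : δ ≤ 1 := hδε.trans (min_le_left _ _)
  have hδM : δ * M ≤ C' := by
    have := hδε.trans (min_le_right _ _)
    rwa [le_div_iff₀ hMpos] at this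
  set y : ℝ := δ / C' with hy
  have hypos : 0 < y := by positivity
  have hd2 : δ ^ 2 ≤ δ ^ expo := by
    rw [← Real.rpow_natCast δ 2]
    exact Real.rpow_le_rpow_of_exponent_ge hδ hδ1 (by exact_mod_cast he2)
  have hde : 0 < δ ^ expo := Real.rpow_pos_of_pos hδ _
  have hlog : Real.log (Real.exp 1 * C' / δ) = 1 - Real.log y := by
    rw [hy, Real.log_div (by positivity) (by positivity), Real.log_mul (by positivity) (by positivity),
      Real.log_exp, Real.log_div (by positivity) (by positivity)]; ring
  rw [hlog]
  have hysum : ∑ t, γ t * (A t r * y) = δ / r := by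
    have : ∑ t, γ t * (A t r * y) = (∑ t, A t r * γ t) * y := by
      rw [Finset.sum_mul]; exact Finset.sum_congr rfl fun t _ => by ring
    rw [this, hCsum, hy]; field_simp
  -- the feasible point
  set b : Fin nc → ℝ := fun t => A t r * y with hb
  have hbn : ∀ t, 0 ≤ b t := fun t => mul_nonneg (hAnn' t r) hypos.le
  have hb1 : ∀ t, b t ≤ 1 := fun t => by
    change A t r * (δ / C') ≤ 1
    rw [mul_div_assoc', div_le_one hCpos]
    nlinarith [hMA t]
  set β0 : Fin nc → ℕ → ℝ := fun t i => if i = 0 then 1 - b t else if i = r then b t else 0 with hβ0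
  have hr0' : r ≠ 0 := by omega
  have hβz : ∀ t, β0 t 0 = 1 - b t := fun t => by simp [hβ0]
  have hβr : ∀ t, β0 t r = b t := fun t => by simp [hβ0, hr0']
  have hβo : ∀ t i, i ≠ 0 → i ≠ r → β0 t i = 0 := fun t i h1 h2 => by simp [hβ0, h1, h2]
  have hsingle : ∀ t (g : ℕ → ℝ), (∀ i, i ≠ 0 → i ≠ r → g i = 0) → (A t r = 0 → g r = 0) →
      ∑ i ∈ (U t).erase 0, g i = g r := fun t g h1 h2 =>
    Finset.sum_eq_single r (fun i hi hir => h1 i (Finset.ne_of_mem_erase hi) hir)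
      (fun h => h2 (hrU t h))
  have hmem : (∑ t, γ t * ∑ i ∈ U t, β0 t i * Real.log (A t i / β0 t i)) ∈ 
      {x : ℝ | ∃ (ev : Fin nc → ℝ) (β : Fin nc → ℕ → ℝ),
            (∀ t, 0 ≤ ev t) ∧ (∑ t, ev t = δ) ∧
            (∀ t i, 0 ≤ β t i) ∧
            (∀ t, ∑ i ∈ U t, β t i = 1) ∧
            (∀ t, ∑ i ∈ (U t).erase 0,
              (i : ℝ) * β t i = ev t / γ t) ∧
            x = ∑ t, γ t * ∑ i ∈ U t, β t i * Real.log (A t i / β t i)} := by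
    refine ⟨fun t => γ t * (r * b t), β0, ?_, ?_, ?_, ?_, ?_, rfl⟩
    · intro t
      exact mul_nonneg (hγ t).le (mul_nonneg hr0.le (hbn t))
    · have : ∑ t, γ t * (r * b t) = r * ∑ t, γ t * (A t r * y) := by
        rw [Finset.mul_sum]; exact Finset.sum_congr rfl fun t _ => by simp only [hb]; ring
      rw [this, hysum]; field_simp
    · intro t i
      simp only [hβ0]
      split_ifs
      · linarith [hb1 t]
      · exact hbn t
      · exact le_rfl
    · intro t
      rw [← Finset.add_sum_erase _ _ (hU0 t), hsingle t _ (hβo t), hβz, hβr]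
      · ring
      · intro h; rw [hβr]; simp [hb, h]
    · intro t
      rw [hsingle t, hβr]
      · have := (hγ t).ne'
        field_simp
      · intro i h1 h2; rw [hβo t i h1 h2, mul_zero]
      · intro h; rw [hβr]; simp [hb, h]
  obtain ⟨W, hW⟩ := aux_compact nc U A hUA γ hγ δ ⟨_, hmem⟩
  refine ⟨W, hW, ?_⟩
  have hlow : δ / r * (1 - Real.log y) - k2 * δ ^ 2 ≤ W := by
    refine le_trans ?_ (hW.2 hmem)
    have hL : δ / r * (1 - Real.log y) - k2 * δ ^ 2 =
        ∑ t, γ t * (b t * (1 - Real.log y) - b t ^ 2) := by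
      rw [← hysum, hk2, Finset.sum_mul, Finset.sum_mul, ← Finset.sum_sub_distrib]
      refine Finset.sum_congr rfl fun t _ => ?_
      simp only [hb, hy]
      field_simp
    rw [hL]
    refine Finset.sum_le_sum fun t _ => mul_le_mul_of_nonneg_left ?_ (hγ t).le
    rw [← Finset.add_sum_erase _ _ (hU0 t), hsingle t, hβz, hβr, hA0]
    · have h1 := aux_low (b t) (hb1 t)
      have h2 : b t * Real.log (A t r / b t) = - (b t * Real.log y) := by
        by_cases h : A t r = 0
        · simp [hb, h]
        · have : A t r / b t = y⁻¹ := by simp only [hb]; field_simp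
          rw [this, Real.log_inv]; ring
      rw [h2]; linarith
    · intro i h1 h2; rw [hβo t i h1 h2, zero_mul]
    · intro h; rw [hβr]; simp [hb, h]
  have hup : W ≤ δ / r * (1 - Real.log y) + k1 * δ ^ expo := by
    obtain ⟨ev, β, h1, h2, h3, h4, h5, rfl⟩ := hW.1
    set x : ℝ := y ^ ((1:ℝ) / r) with hx
    have hxpos : 0 < x := Real.rpow_pos_of_pos hypos _
    have hlx : Real.log x = Real.log y / r := by
      rw [hx, Real.log_rpow hypos]; ring
    have hxi : ∀ i : ℕ, x ^ i = y ^ ((i:ℝ) / r) := fun i => by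
      rw [hx, ← Real.rpow_mul_natCast hypos.le]; congr 1; ring
    have hxr : x ^ r = y := by
      rw [hxi, div_self hr0.ne', Real.rpow_one]
    have step : ∀ t, γ t * ∑ i ∈ U t, β t i * Real.log (A t i / β t i) ≤
        γ t * (A t r * y) + γ t * (∑ i ∈ (U t).erase 0, A t i * (1 / C') ^ ((i:ℝ) / r)) * δ ^ expo
          - Real.log x * ev t := by
      intro t
      have hg := aux_gibbs (U t) (hU0 t) (A t) (β t) (hA0 t) (hUA t) (h3 t) (h4 t) x hxpos
      rw [h5 t] at hg
      have hs : ∑ i ∈ (U t).erase 0, A t i * x ^ i ≤ A t r * y +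
          (∑ i ∈ (U t).erase 0, A t i * (1 / C') ^ ((i:ℝ) / r)) * δ ^ expo := by
        have e : ∑ i ∈ (U t).erase 0, (if i = r then A t r * y else 0) = A t r * y := by
          rw [hsingle t]
          · simp
          · intro i _ h; simp [h]
          · intro h; simp [h]
        rw [← e, Finset.sum_mul, ← Finset.sum_add_distrib]
        refine Finset.sum_le_sum fun i hi => ?_
        have hA' := hUA t i (Finset.mem_of_mem_erase hi)
        by_cases hir : i = r
        · subst hir
          rw [if_pos rfl, hxr]
          have : 0 ≤ A t i * (1 / C') ^ ((i:ℝ) / i) * δ ^ expo := by positivity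
          linarith
        · rw [if_neg hir, zero_add, hxi]
          have hlt : r < i := lt_of_le_of_ne (hUr t i hi) (Ne.symm hir)
          have : y ^ ((i:ℝ) / r) = (1 / C') ^ ((i:ℝ) / r) * δ ^ ((i:ℝ) / r) := by
            rw [← Real.mul_rpow (by positivity) hδ.le]; congr 1; rw [hy]; ring
          rw [this, ← mul_assoc]
          refine mul_le_mul_of_nonneg_left ?_ (by positivity)
          exact Real.rpow_le_rpow_of_exponent_ge hδ hδ1 (hei t i hlt hA')
      have h6 := mul_le_mul_of_nonneg_left (hg.trans (sub_le_sub_right hs _)) (hγ t).le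
      refine h6.trans (le_of_eq ?_)
      have := (hγ t).ne'
      field_simp
    refine (Finset.sum_le_sum fun t _ => step t).trans (le_of_eq ?_)
    rw [Finset.sum_sub_distrib, Finset.sum_add_distrib, ← Finset.mul_sum, h2, hysum,
      ← Finset.sum_mul, hlx]
    ring
  rw [abs_le]
  constructor
  · nlinarith [mul_le_mul_of_nonneg_left hd2 hk2n, mul_nonneg hk1n hde.le]
  · nlinarith [mul_nonneg hk2n hde.le]
end

section
/- Exponential behavior of the probability that a random assignment is check-valid. With the D-GLDPC ensemble notation, for beta > 0 let P_valid(beta n) = N_c(beta n) / binom(E, beta n), the probability that a uniformly random weight-(beta n) subset of the E = n/int_lambda Tanner graph edges is check-valid, where N_c(v) is the coefficient of x^v in prod_{t in I_c} (A^{(t)}(x))^{gamma_t m} and m = E int_rho. Then for every sufficiently small admissible rational beta > 0 the limit Y(beta) := lim_{n -> infinity} (1/n) log P_valid(beta n) exists (over the infinitely many n making all quantities integral and N_c(beta n) > 0), and Y(beta) = (beta/r) log( e C / (beta int_lambda) ) - beta log( e / (beta int_lambda) ) + O( beta^{min{rbar/r, 2}} ) as beta -> 0+. -/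
open Filter Polynomial Finset
open scoped Classical

/-- The data of a D-GLDPC ensemble needed on the check-node side: CN types `Fin nc` with
lengths `s`, dimensions `hdim`, minimum distances `rd`, weight enumerator coefficients
`A`, edge fractions `ρ`; and VN lengths `q` with edge fractions `lam`. -/
structure CNEnsemble where
  nc : ℕ
  nv : ℕ
  hnc : 0 < nc
  hnv : 0 < nv
  s : Fin nc → ℕ
  hdim : Fin nc → ℕ
  rd : Fin nc → ℕ
  A : Fin nc → ℕ → ℕ
  q : Fin nv → ℕ
  ρ : Fin nc → ℝ
  lam : Fin nv → ℝ
  h_hdim : ∀ t, 1 ≤ hdim t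
  h_hs : ∀ t, hdim t < s t
  h_rd2 : ∀ t, 2 ≤ rd t
  h_rds : ∀ t, rd t ≤ s t
  hA0 : ∀ t, A t 0 = 1
  hAsupp : ∀ t u, u ≠ 0 → (u < rd t ∨ s t < u) → A t u = 0
  hAr : ∀ t, 0 < A t (rd t)
  h_q1 : ∀ t, 1 ≤ q t
  hρpos : ∀ t, 0 < ρ t
  hlampos : ∀ t, 0 < lam t
  hρsum : ∑ t, ρ t = 1
  hlamsum : ∑ t, lam t = 1

namespace CNEnsemble

variable (M : CNEnsemble)

noncomputable def intrho : ℝ := ∑ t, M.ρ t / (M.s t : ℝ)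

noncomputable def intlam : ℝ := ∑ t, M.lam t / (M.q t : ℝ)

/-- `r`: the smallest CN minimum distance. -/
noncomputable def r : ℕ := sInf (Set.range M.rd)

/-- `C = r ∑_{t ∈ X_c} ρ_t A_r^{(t)} / s_t`. -/
noncomputable def Cparam : ℝ :=
  (M.r : ℝ) * ∑ t ∈ Finset.univ.filter (fun t => M.rd t = M.r),
    M.ρ t * (M.A t M.r : ℝ) / (M.s t : ℝ)

/-- Number of Tanner graph edges, `E = n/∫λ` (exact on admissible `n`). -/
noncomputable def En (n : ℕ) : ℕ := ⌊(n : ℝ) / M.intlam⌋₊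

/-- Number of CNs of type `t`, `γ_t m = E ρ_t / s_t` (exact on admissible `n`). -/
noncomputable def cExp (n : ℕ) (t : Fin M.nc) : ℕ := ⌊(M.En n : ℝ) * M.ρ t / (M.s t : ℝ)⌋₊

/-- The CN weight enumerating polynomial `A^{(t)}(x)`. -/
noncomputable def Apoly (t : Fin M.nc) : Polynomial ℝ :=
  ∑ u ∈ Finset.range (M.s t + 1), Polynomial.C ((M.A t u : ℕ) : ℝ) * Polynomial.X ^ u

/-- `N_c(v)`: the number of check-valid assignments of weight `v`. -/
noncomputable def NcCount (n v : ℕ) : ℝ := (∏ t, M.Apoly t ^ M.cExp n t).coeff v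

/-- The probability that a uniformly random weight-`βn` subset of the `E` edges is
check-valid: `P_valid(βn) = N_c(βn)/binom(E, βn)`. -/
noncomputable def Pvalid (β : ℝ) (n : ℕ) : ℝ :=
  M.NcCount n ⌊β * (n : ℝ)⌋₊ / ((M.En n).choose ⌊β * (n : ℝ)⌋₊ : ℝ)

/-- Admissibility of `n` for `β`: all relevant quantities are integers and
`N_c(βn) > 0`. -/
def Adm (β : ℝ) (n : ℕ) : Prop :=
  0 < n ∧ ((M.En n : ℝ) = (n : ℝ) / M.intlam) ∧
  (∀ t, (M.cExp n t : ℝ) = (M.En n : ℝ) * M.ρ t / (M.s t : ℝ)) ∧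
  ((⌊β * (n : ℝ)⌋₊ : ℝ) = β * (n : ℝ)) ∧
  0 < M.NcCount n ⌊β * (n : ℝ)⌋₊

/-- The exponent `min{r̄/r, 2}`, encoded as the infimum of
`{2} ∪ {i/r : i > r, A_i^{(t)} > 0 for some t}`. -/
noncomputable def expo : ℝ :=
  sInf ({2} ∪ {x : ℝ | ∃ i : ℕ, M.r < i ∧ (∃ t, 0 < M.A t i) ∧ x = (i : ℝ) / (M.r : ℝ)})

end CNEnsemble

lemma aux_fekete (S : Set ℕ) (hpos : ∀ n ∈ S, 0 < n) (hadd : ∀ n ∈ S, ∀ m ∈ S, n + m ∈ S)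
    (a : ℕ → ℝ) (ha : ∀ n ∈ S, ∀ m ∈ S, a n + a m ≤ a (n + m)) (B : ℝ)
    (hB : ∀ n ∈ S, a n / n ≤ B) (hne : S.Nonempty) :
    ∃ Y : ℝ, Tendsto (fun n : ℕ => a n / n) (atTop ⊓ 𝓟 S) (nhds Y) := by
  have hbdd : BddAbove ((fun n : ℕ => a n / n) '' S) := by
    refine ⟨B, ?_⟩
    rintro _ ⟨n, hn, rfl⟩
    exact hB n hn
  refine ⟨sSup ((fun n : ℕ => a n / n) '' S), ?_⟩
  rw [tendsto_order]
  constructor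
  · intro b hb
    obtain ⟨_, ⟨m, hm, rfl⟩, hbm⟩ := exists_lt_of_lt_csSup (hne.image _) hb
    have hm0 := hpos m hm
    have hm0' : (0:ℝ) < m := by exact_mod_cast hm0
    simp only at hbm
    rw [lt_div_iff₀ hm0'] at hbm
    rw [eventually_inf_principal]
    have key : ∀ i ∈ Finset.range m, ∀ᶠ n : ℕ in atTop, n % m = i → n ∈ S → b < a n / n := by
      intro i _
      by_cases h : ∃ n₀ ∈ S, n₀ % m = i
      · obtain ⟨n₀, hn₀, hi⟩ := h
        have hk : ∀ k : ℕ, n₀ + k * m ∈ S ∧ a n₀ + k * a m ≤ a (n₀ + k * m) := by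
          intro k
          induction k with
          | zero => simp [hn₀]
          | succ k ih =>
            have e : n₀ + (k+1) * m = (n₀ + k * m) + m := by ring
            rw [e]
            refine ⟨hadd _ ih.1 _ hm, ?_⟩
            have := ha _ ih.1 _ hm
            push_cast
            linarith [ih.2]
        obtain ⟨k₀, hk₀⟩ := exists_nat_gt ((b * n₀ - a n₀) / (a m - b * m))
        filter_upwards [eventually_ge_atTop (n₀ + k₀ * m)] with n hn hni hnS
        have hmod : n₀ ≡ n [MOD m] := by rw [Nat.ModEq, hi, hni]
        have hle : n₀ ≤ n := le_trans (Nat.le_add_right _ _) hn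
        obtain ⟨k, hk'⟩ := (Nat.modEq_iff_dvd' hle).1 hmod
        have hnk : n = n₀ + k * m := by rw [mul_comm k]; omega
        have hkk : k₀ ≤ k := by
          rw [hnk] at hn
          exact Nat.le_of_mul_le_mul_right (by omega) hm0
        have hn0 : (0:ℝ) < n := by exact_mod_cast hpos n hnS
        rw [lt_div_iff₀ hn0]
        have h1 := (hk k).2
        rw [← hnk] at h1
        have hd : 0 < a m - b * m := by linarith
        rw [div_lt_iff₀ hd] at hk₀
        have hkk' : (k₀:ℝ) ≤ k := by exact_mod_cast hkk
        have h2 : (k₀:ℝ) * (a m - b * m) ≤ k * (a m - b * m) :=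
          mul_le_mul_of_nonneg_right hkk' hd.le
        have h3 : (n:ℝ) = n₀ + k * m := by exact_mod_cast hnk
        rw [h3]
        nlinarith
      · refine Eventually.of_forall fun n hni hnS => absurd ⟨n, hnS, hni⟩ h
    rw [← Filter.eventually_all_finset] at key
    filter_upwards [key] with n hn hnS
    exact hn (n % m) (Finset.mem_range.2 (Nat.mod_lt _ hm0)) rfl hnS
  · intro b hb
    rw [eventually_inf_principal]
    refine Eventually.of_forall fun n hn => lt_of_le_of_lt (le_csSup hbdd ⟨n, hn, rfl⟩) hb

lemma aux_log_fact (w : ℕ) (hw : 1 ≤ w) :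
    Real.log (w.factorial : ℝ) ≤ (w + 1) * Real.log w - w + 1 := by
  induction w, hw using Nat.le_induction with
  | base => simp
  | succ w hw ih =>
    have hw0 : (0:ℝ) < w := by exact_mod_cast hw
    rw [Nat.factorial_succ]
    push_cast
    rw [Real.log_mul (by positivity) (by positivity)]
    have h1 := Real.log_le_sub_one_of_pos (show (0:ℝ) < w / (w+1) by positivity)
    rw [Real.log_div (by positivity) (by positivity)] at h1
    have h2 : ((w:ℝ)+1) * (Real.log w - Real.log (w+1)) ≤ (w+1) * (w / (w+1) - 1) :=
      mul_le_mul_of_nonneg_left h1 (by positivity)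
    have h3 : ((w:ℝ)+1) * (w / (w+1) - 1) = -1 := by field_simp; ring
    nlinarith

lemma aux_term_s17 (c w A : ℕ) (θ : ℝ) (hθ : 0 < θ) (hw : (w:ℝ) = θ * A * c)
    (hA : θ * A ≤ 1 / 2) :
    w * Real.log (Real.exp 1 / θ) - 2 * θ ^ 2 * A ^ 2 * c - Real.log (w + 1) - 1 ≤
      Real.log ((c.choose w : ℝ) * (A:ℝ) ^ w) := by
  rcases Nat.eq_zero_or_pos w with rfl | hwp
  · simp
    have : 0 ≤ 2 * θ ^ 2 * A ^ 2 * c := by positivity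
    linarith
  have hwp' : (0:ℝ) < w := by exact_mod_cast hwp
  have hA0 : (0:ℝ) < A := by
    rcases Nat.eq_zero_or_pos A with rfl | h
    · simp at hw; omega
    · exact_mod_cast h
  have hc0 : (0:ℝ) < c := by
    rcases Nat.eq_zero_or_pos c with rfl | h
    · simp at hw; omega
    · exact_mod_cast h
  have hwc : (w:ℝ) ≤ c / 2 := by rw [hw]; nlinarith
  have hwc' : w ≤ c := by
    have : (w:ℝ) ≤ c := by linarith
    exact_mod_cast this
  have h1 : ((c:ℝ) - w) ^ w / (w.factorial : ℝ) ≤ (c.choose w : ℝ) := by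
    have h := Nat.pow_le_choose (α := ℝ) w c
    refine le_trans ?_ h
    have : (c:ℝ) - w ≤ ((c + 1 - w : ℕ) : ℝ) := by
      rw [Nat.cast_sub (by omega)]; push_cast; linarith
    have h0 : (0:ℝ) ≤ c - w := by linarith
    gcongr
  have hcw : (0:ℝ) < c - w := by linarith
  have hchoose : (0:ℝ) < c.choose w := by exact_mod_cast Nat.choose_pos hwc'
  have h2 := Real.log_le_log (by positivity) h1
  rw [Real.log_div (by positivity) (by positivity), Real.log_pow] at h2
  have h3 := aux_log_fact w hwp
  rw [Real.log_mul hchoose.ne' (by positivity), Real.log_pow]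
  have h4 : Real.log c - 2 * (θ * A) ≤ Real.log (c - w) := by
    have e : (c:ℝ) - w = c * (1 - θ * A) := by rw [hw]; ring
    have hp : 0 < 1 - θ * A := by linarith
    rw [e, Real.log_mul (by positivity) hp.ne']
    have := Real.one_sub_inv_le_log_of_pos hp
    have h5 : (1 - θ * A)⁻¹ ≤ 1 + 2 * (θ * A) := by
      rw [inv_le_iff_one_le_mul₀ hp]
      have : 0 < θ * A := by positivity
      nlinarith
    linarith
  have h6 : Real.log (Real.exp 1 / θ) = 1 - Real.log θ := by
    rw [Real.log_div (by positivity) (by positivity), Real.log_exp]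
  have h7 : Real.log w = Real.log θ + Real.log A + Real.log c := by
    rw [hw, Real.log_mul (by positivity) (by positivity),
      Real.log_mul (by positivity) (by positivity)]
  have h8 : Real.log w ≤ Real.log (w + 1) := Real.log_le_log hwp' (by linarith)
  have h9 : (w:ℝ) * (Real.log c - 2 * (θ * A)) ≤ w * Real.log (c - w) :=
    mul_le_mul_of_nonneg_left h4 hwp'.le
  have h10 : (w:ℝ) * (2 * (θ * A)) = 2 * θ ^ 2 * A ^ 2 * c := by rw [hw]; ring
  have h11 : (w:ℝ) * Real.log w = w * (Real.log θ + Real.log A + Real.log c) := by rw [h7]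
  rw [h6]
  nlinarith

lemma aux_coeff_mul {P Q : Polynomial ℝ} (hP : ∀ i, 0 ≤ P.coeff i) (hQ : ∀ i, 0 ≤ Q.coeff i)
    (v w : ℕ) : P.coeff v * Q.coeff w ≤ (P * Q).coeff (v + w) := by
  rw [Polynomial.coeff_mul]
  exact Finset.single_le_sum (f := fun x : ℕ × ℕ => P.coeff x.1 * Q.coeff x.2)
    (fun x _ => mul_nonneg (hP _) (hQ _)) (a := (v, w)) (by simp)

lemma aux_nn_mul {P Q : Polynomial ℝ} (hP : ∀ i, 0 ≤ P.coeff i) (hQ : ∀ i, 0 ≤ Q.coeff i) :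
    ∀ i, 0 ≤ (P * Q).coeff i := by
  intro i
  rw [Polynomial.coeff_mul]
  exact Finset.sum_nonneg fun x _ => mul_nonneg (hP _) (hQ _)

lemma aux_nn_pow {P : Polynomial ℝ} (hP : ∀ i, 0 ≤ P.coeff i) (c : ℕ) :
    ∀ i, 0 ≤ (P ^ c).coeff i := by
  induction c with
  | zero => intro i; rw [pow_zero, Polynomial.coeff_one]; split_ifs <;> norm_num
  | succ c ih => rw [pow_succ]; exact aux_nn_mul ih hP

lemma aux_nn_prod {ι : Type*} (s : Finset ι) (P : ι → Polynomial ℝ)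
    (hP : ∀ t i, 0 ≤ (P t).coeff i) : ∀ i, 0 ≤ (∏ t ∈ s, P t).coeff i := by
  induction s using Finset.induction_on with
  | empty => intro i; rw [Finset.prod_empty, Polynomial.coeff_one]; split_ifs <;> norm_num
  | insert a s ha ih => rw [Finset.prod_insert ha]; exact aux_nn_mul (hP a) ih

lemma aux_coeff_prod {ι : Type*} (s : Finset ι) (P : ι → Polynomial ℝ)
    (hP : ∀ t i, 0 ≤ (P t).coeff i) (v : ι → ℕ) :
    ∏ t ∈ s, (P t).coeff (v t) ≤ (∏ t ∈ s, P t).coeff (∑ t ∈ s, v t) := by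
  induction s using Finset.induction_on with
  | empty => simp
  | insert a s ha ih =>
    rw [Finset.prod_insert ha, Finset.prod_insert ha, Finset.sum_insert ha]
    exact le_trans (mul_le_mul_of_nonneg_left ih (hP _ _))
      (aux_coeff_mul (hP a) (aux_nn_prod s P hP) _ _)

lemma aux_coeff_pow {P : Polynomial ℝ} (hP : ∀ i, 0 ≤ P.coeff i) (h0 : P.coeff 0 = 1)
    (r : ℕ) (hr : 0 < r) (c w : ℕ) :
    (c.choose w : ℝ) * (P.coeff r) ^ w ≤ (P ^ c).coeff (r * w) := by
  induction c generalizing w with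
  | zero =>
    cases w with
    | zero => simp
    | succ w => simpa using aux_nn_pow hP 0 (r * (w+1))
  | succ c ih =>
    cases w with
    | zero =>
      have := ih 0
      have h2 := aux_coeff_mul (aux_nn_pow hP c) hP 0 0
      simp [h0] at this h2 ⊢
      rw [pow_succ]
      simp [h0]
      linarith
    | succ w =>
      rw [Nat.choose_succ_succ, pow_succ P, Polynomial.coeff_mul]
      have hsub : ({(r * w, r), (r * (w+1), 0)} : Finset (ℕ × ℕ)) ⊆
          Finset.HasAntidiagonal.antidiagonal (r * (w+1)) := by
        intro x hx
        simp only [Finset.mem_insert, Finset.mem_singleton] at hx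
        rcases hx with rfl | rfl <;> simp; ring
      have hle := Finset.sum_le_sum_of_subset_of_nonneg
        (f := fun x : ℕ × ℕ => (P ^ c).coeff x.1 * P.coeff x.2) hsub
        (fun x _ _ => mul_nonneg (aux_nn_pow hP c _) (hP _))
      rw [Finset.sum_pair (by simp; omega)] at hle
      refine le_trans ?_ hle
      simp only [h0]
      have i1 := mul_le_mul_of_nonneg_right (ih w) (hP r)
      have i2 := ih (w+1)
      push_cast
      rw [pow_succ] at i2 ⊢
      nlinarith

lemma aux_eval {P : Polynomial ℝ} (hP : ∀ i, 0 ≤ P.coeff i) (x : ℝ) (hx : 0 ≤ x) (v : ℕ) :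
    P.coeff v * x ^ v ≤ P.eval x := by
  by_cases hv : v ∈ P.support
  · rw [Polynomial.eval_eq_sum, Polynomial.sum]
    exact Finset.single_le_sum (f := fun i => P.coeff i * x ^ i)
      (fun i _ => mul_nonneg (hP i) (pow_nonneg hx i)) hv
  · rw [Polynomial.notMem_support_iff.1 hv, zero_mul, Polynomial.eval_eq_sum, Polynomial.sum]
    exact Finset.sum_nonneg fun i _ => mul_nonneg (hP i) (pow_nonneg hx i)

namespace CNEnsemble

lemma aux_intlam_pos (M : CNEnsemble) : 0 < M.intlam := by
  unfold intlam
  have : Nonempty (Fin M.nv) := ⟨⟨0, M.hnv⟩⟩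
  apply Finset.sum_pos
  · intro t _
    have h1 := M.hlampos t
    have h2 : (0:ℝ) < M.q t := by exact_mod_cast M.h_q1 t
    positivity
  · exact Finset.univ_nonempty

lemma aux_s_pos (M : CNEnsemble) (t : Fin M.nc) : (0:ℝ) < M.s t := by
  have := M.h_hs t
  exact_mod_cast (by omega : 0 < M.s t)

lemma aux_r_mem (M : CNEnsemble) : ∃ t, M.rd t = M.r := by
  have : Nonempty (Fin M.nc) := ⟨⟨0, M.hnc⟩⟩
  exact Nat.sInf_mem (Set.range_nonempty M.rd)

lemma aux_r_le (M : CNEnsemble) (t : Fin M.nc) : M.r ≤ M.rd t := Nat.sInf_le ⟨t, rfl⟩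

lemma aux_r_pos (M : CNEnsemble) : 0 < M.r := by
  obtain ⟨t, ht⟩ := M.aux_r_mem
  have := M.h_rd2 t
  omega

lemma aux_C_eq (M : CNEnsemble) :
    M.Cparam = (M.r : ℝ) * ∑ t, M.ρ t * (M.A t M.r : ℝ) / (M.s t : ℝ) := by
  unfold Cparam
  congr 1
  apply Finset.sum_subset (Finset.filter_subset _ _)
  intro t _ ht
  have h1 : M.rd t ≠ M.r := by simpa using ht
  have h2 := M.aux_r_le t
  have h3 := M.hAsupp t M.r M.aux_r_pos.ne' (Or.inl (by omega))
  rw [h3]; simp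

lemma aux_C_pos (M : CNEnsemble) : 0 < M.Cparam := by
  rw [aux_C_eq]
  have hr : (0:ℝ) < M.r := by exact_mod_cast M.aux_r_pos
  refine mul_pos hr ?_
  obtain ⟨t, ht⟩ := M.aux_r_mem
  refine Finset.sum_pos' ?_ ⟨t, Finset.mem_univ _, ?_⟩
  · intro t _
    have := M.hρpos t
    positivity
  · have h1 := M.hρpos t
    have h2 := M.aux_s_pos t
    have h3 : (0:ℝ) < M.A t M.r := by rw [← ht]; exact_mod_cast M.hAr t
    positivity

lemma aux_coeff (M : CNEnsemble) (t : Fin M.nc) (u : ℕ) :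
    (M.Apoly t).coeff u = M.A t u := by
  unfold Apoly
  simp only [Polynomial.finsetSum_coeff, Polynomial.coeff_C_mul, Polynomial.coeff_X_pow]
  simp only [mul_ite, mul_one, mul_zero, Finset.sum_ite_eq, Finset.mem_range]
  split_ifs with h
  · rfl
  · rw [M.hAsupp t u (by omega) (Or.inr (by omega))]; simp

lemma aux_nn (M : CNEnsemble) (t : Fin M.nc) (u : ℕ) : 0 ≤ (M.Apoly t).coeff u := by
  rw [aux_coeff]; positivity

lemma aux_expo_bdd (M : CNEnsemble) : BddBelow
    ({2} ∪ {x : ℝ | ∃ i : ℕ, M.r < i ∧ (∃ t, 0 < M.A t i) ∧ x = (i : ℝ) / (M.r : ℝ)}) := by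
  refine ⟨0, ?_⟩
  rintro x (rfl | ⟨i, _, _, rfl⟩)
  · norm_num
  · positivity

lemma aux_expo_le_two (M : CNEnsemble) : M.expo ≤ 2 :=
  csInf_le M.aux_expo_bdd (Or.inl rfl)

lemma aux_expo_le (M : CNEnsemble) (t : Fin M.nc) (i : ℕ) (hi : M.r < i) (hA : 0 < M.A t i) :
    M.expo ≤ (i : ℝ) / M.r :=
  csInf_le M.aux_expo_bdd (Or.inr ⟨i, hi, ⟨t, hA⟩, rfl⟩)

lemma aux_eval_le (M : CNEnsemble) (t : Fin M.nc) (x : ℝ) (hx : 0 < x) (hx1 : x ≤ 1) :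
    (M.Apoly t).eval x ≤ 1 + M.A t M.r * x ^ M.r +
      (∑ u ∈ Finset.range (M.s t + 1), (M.A t u : ℝ)) * (x ^ M.r) ^ M.expo := by
  have hrs : M.r ≤ M.s t := (M.aux_r_le t).trans (M.h_rds t)
  have hr : (0:ℝ) < M.r := by exact_mod_cast M.aux_r_pos
  unfold Apoly
  rw [Polynomial.eval_finsetSum]
  have key : ∀ u ∈ Finset.range (M.s t + 1),
      (Polynomial.C ((M.A t u : ℕ) : ℝ) * Polynomial.X ^ u).eval x ≤
      (if u = 0 then (1:ℝ) else 0) + (if u = M.r then (M.A t M.r : ℝ) * x ^ M.r else 0) +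
        (M.A t u : ℝ) * (x ^ M.r) ^ M.expo := by
    intro u _
    simp only [Polynomial.eval_mul, Polynomial.eval_C, Polynomial.eval_pow, Polynomial.eval_X]
    have hnn : 0 ≤ (M.A t u : ℝ) * (x ^ M.r) ^ M.expo := by positivity
    rcases Nat.eq_zero_or_pos u with rfl | hu
    · have : (0:ℕ) ≠ M.r := M.aux_r_pos.ne
      have h1 : (M.A t 0 : ℝ) = 1 := by exact_mod_cast M.hA0 t
      rw [if_pos rfl, if_neg this, pow_zero, mul_one]
      linarith
    · rw [if_neg hu.ne']
      by_cases h : u = M.r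
      · rw [if_pos h]; rw [h] at hnn ⊢; linarith
      · rw [if_neg h]
        rcases Nat.eq_zero_or_pos (M.A t u) with hA | hA
        · rw [hA]; simp
        · have hlt : M.r < u := by
            by_contra hcon
            have := M.aux_r_le t
            have := M.hAsupp t u hu.ne' (Or.inl (by omega))
            omega
          have h2 := M.aux_expo_le t u hlt hA
          rw [le_div_iff₀ hr] at h2
          have h3 : x ^ u ≤ (x ^ M.r) ^ M.expo := by
            rw [← Real.rpow_natCast x M.r, ← Real.rpow_mul hx.le, ← Real.rpow_natCast x u]
            exact Real.rpow_le_rpow_of_exponent_ge hx hx1 (by linarith)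
          have := mul_le_mul_of_nonneg_left h3 (Nat.cast_nonneg (α := ℝ) (M.A t u))
          linarith
  refine (Finset.sum_le_sum key).trans (le_of_eq ?_)
  rw [Finset.sum_add_distrib, Finset.sum_add_distrib, Finset.sum_ite_eq', Finset.sum_ite_eq',
    if_pos (by simp), if_pos (by simp; omega), Finset.sum_mul]

lemma aux_c (M : CNEnsemble) {β : ℝ} {n : ℕ} (h : M.Adm β n) (t : Fin M.nc) :
    (M.cExp n t : ℝ) = n / M.intlam * (M.ρ t / M.s t) := by
  rw [h.2.2.1 t, h.2.1]; ring

lemma aux_add (M : CNEnsemble) {β : ℝ} {n m : ℕ} (hn : M.Adm β n) (hm : M.Adm β m) :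
    M.En (n + m) = M.En n + M.En m ∧ (∀ t, M.cExp (n + m) t = M.cExp n t + M.cExp m t) ∧
    ⌊β * ((n + m : ℕ) : ℝ)⌋₊ = ⌊β * (n : ℝ)⌋₊ + ⌊β * (m : ℝ)⌋₊ ∧ 
    M.NcCount n ⌊β * (n : ℝ)⌋₊ * M.NcCount m ⌊β * (m : ℝ)⌋₊ ≤
      M.NcCount (n + m) ⌊β * ((n + m : ℕ) : ℝ)⌋₊ ∧ M.Adm β (n + m) := by
  have hE : M.En (n + m) = M.En n + M.En m := by
    have : ((n + m : ℕ) : ℝ) / M.intlam = ((M.En n + M.En m : ℕ) : ℝ) := by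
      push_cast; rw [hn.2.1, hm.2.1]; ring
    conv_lhs => unfold En
    rw [this, Nat.floor_natCast]
  have hc : ∀ t, M.cExp (n + m) t = M.cExp n t + M.cExp m t := by
    intro t
    have : (M.En (n + m) : ℝ) * M.ρ t / (M.s t : ℝ) = ((M.cExp n t + M.cExp m t : ℕ) : ℝ) := by
      push_cast; rw [hn.2.2.1, hm.2.2.1, hE]; push_cast; ring
    conv_lhs => unfold cExp
    rw [this, Nat.floor_natCast]
  have hv : ⌊β * ((n + m : ℕ) : ℝ)⌋₊ = ⌊β * (n : ℝ)⌋₊ + ⌊β * (m : ℝ)⌋₊ := by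
    have : β * ((n + m : ℕ) : ℝ) = ((⌊β * (n : ℝ)⌋₊ + ⌊β * (m : ℝ)⌋₊ : ℕ) : ℝ) := by
      push_cast; rw [hn.2.2.2.1, hm.2.2.2.1]; ring
    rw [this, Nat.floor_natCast]
  have hN : M.NcCount n ⌊β * (n : ℝ)⌋₊ * M.NcCount m ⌊β * (m : ℝ)⌋₊ ≤
      M.NcCount (n + m) ⌊β * ((n + m : ℕ) : ℝ)⌋₊ := by
    rw [hv]
    unfold NcCount
    simp only [hc, pow_add, Finset.prod_mul_distrib]
    exact aux_coeff_mul (aux_nn_prod _ _ fun t => aux_nn_pow (M.aux_nn t) _)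
      (aux_nn_prod _ _ fun t => aux_nn_pow (M.aux_nn t) _) _ _
  refine ⟨hE, hc, hv, hN, ?_, ?_, ?_, ?_, ?_⟩
  · have := hn.1; omega
  · rw [hE]; push_cast; rw [hn.2.1, hm.2.1]; ring
  · intro t
    rw [hc, hE]; push_cast; rw [hn.2.2.1, hm.2.2.1]; ring
  · rw [hv]; push_cast; rw [hn.2.2.2.1, hm.2.2.2.1]; ring
  · exact lt_of_lt_of_le (mul_pos hn.2.2.2.2 hm.2.2.2.2) hN

lemma aux_adm_mul (M : CNEnsemble) {β : ℝ} {n : ℕ} (hn : M.Adm β n) (k : ℕ) (hk : 1 ≤ k) :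
    M.Adm β (k * n) := by
  induction k, hk using Nat.le_induction with
  | base => simpa using hn
  | succ k hk ih => rw [Nat.succ_mul]; exact (M.aux_add ih hn).2.2.2.2

lemma aux_upper (M : CNEnsemble) {β : ℝ} (hβ : 0 < β) (hθ : β * M.intlam / M.Cparam ≤ 1)
    {n : ℕ} (hn : M.Adm β n) :
    Real.log (M.NcCount n ⌊β * (n : ℝ)⌋₊) / n ≤
      β / M.r * Real.log (Real.exp 1 * M.Cparam / (β * M.intlam)) +
      ((∑ t, M.ρ t / M.s t / M.intlam * ∑ u ∈ Finset.range (M.s t + 1), (M.A t u : ℝ)) *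
        (M.intlam / M.Cparam) ^ M.expo) * β ^ M.expo := by
  have hL := M.aux_intlam_pos
  have hC := M.aux_C_pos
  have hr : (0:ℝ) < M.r := by exact_mod_cast M.aux_r_pos
  have hn0 : (0:ℝ) < n := by exact_mod_cast hn.1
  set θ := β * M.intlam / M.Cparam with hθdef
  have hθ0 : 0 < θ := by positivity
  set x := θ ^ (1 / (M.r : ℝ)) with hxdef
  have hx0 : 0 < x := by positivity
  have hx1 : x ≤ 1 := Real.rpow_le_one hθ0.le hθ (by positivity)
  have hxr : x ^ M.r = θ := by
    rw [hxdef, ← Real.rpow_natCast, ← Real.rpow_mul hθ0.le]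
    rw [one_div, inv_mul_cancel₀ hr.ne', Real.rpow_one]
  have hlogx : Real.log x = Real.log θ / M.r := by
    rw [hxdef, Real.log_rpow hθ0]; ring
  have hN := hn.2.2.2.2
  set v := ⌊β * (n : ℝ)⌋₊ with hv
  have hvr : (v:ℝ) = β * n := hn.2.2.2.1
  have h1 := aux_eval (aux_nn_prod Finset.univ (fun t => M.Apoly t ^ M.cExp n t)
    fun t => aux_nn_pow (M.aux_nn t) _) x hx0.le v
  change M.NcCount n v * x ^ v ≤ _ at h1
  rw [Polynomial.eval_prod] at h1
  simp only [Polynomial.eval_pow] at h1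
  have hev : ∀ t, 0 < (M.Apoly t).eval x := by
    intro t
    have := aux_eval (M.aux_nn t) x hx0.le 0
    rw [aux_coeff, M.hA0] at this
    simp at this
    linarith
  have h2 := Real.log_le_log (by positivity) h1
  rw [Real.log_mul hN.ne' (by positivity), Real.log_pow,
    Real.log_prod (fun t _ => (pow_pos (hev t) _).ne')] at h2
  simp only [Real.log_pow] at h2
  have h3 : ∀ t ∈ (Finset.univ : Finset (Fin M.nc)),
      (M.cExp n t : ℝ) * Real.log ((M.Apoly t).eval x) ≤
      n * (θ / M.intlam * (M.ρ t * M.A t M.r / M.s t)) + n * (θ ^ M.expo *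
        (M.ρ t / M.s t / M.intlam * ∑ u ∈ Finset.range (M.s t + 1), (M.A t u : ℝ))) := by
    intro t _
    have e1 := Real.log_le_sub_one_of_pos (hev t)
    have e2 := M.aux_eval_le t x hx0 hx1
    rw [hxr] at e2
    have e3 := mul_le_mul_of_nonneg_left (show Real.log ((M.Apoly t).eval x) ≤
      M.A t M.r * θ + (∑ u ∈ Finset.range (M.s t + 1), (M.A t u : ℝ)) * θ ^ M.expo by linarith)
      (Nat.cast_nonneg (α := ℝ) (M.cExp n t))
    refine e3.trans (le_of_eq ?_)
    rw [M.aux_c hn]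
    ring
  have h4 := h2.trans (Finset.sum_le_sum h3)
  rw [Finset.sum_add_distrib, ← Finset.mul_sum, ← Finset.mul_sum, ← Finset.mul_sum,
    ← Finset.mul_sum] at h4
  have h5 : ∑ t, M.ρ t * (M.A t M.r : ℝ) / (M.s t : ℝ) = M.Cparam / M.r := by
    rw [aux_C_eq]; field_simp
  rw [h5] at h4
  have h6 : θ / M.intlam * (M.Cparam / M.r) = β / M.r := by rw [hθdef]; field_simp
  have h7 : θ ^ M.expo = (M.intlam / M.Cparam) ^ M.expo * β ^ M.expo := by
    rw [← Real.mul_rpow (by positivity) hβ.le, hθdef]; congr 1; ring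
  have h8 : Real.log (Real.exp 1 * M.Cparam / (β * M.intlam)) = 1 - Real.log θ := by
    have : Real.exp 1 * M.Cparam / (β * M.intlam) = Real.exp 1 / θ := by
      rw [hθdef]; field_simp
    rw [this, Real.log_div (by positivity) (by positivity), Real.log_exp]
  rw [h6, h7, hlogx, hvr] at h4
  rw [h8, div_le_iff₀ hn0]
  refine le_of_sub_nonneg ?_
  refine (sub_nonneg_of_le h4).trans (le_of_eq ?_)
  ring

lemma aux_lower (M : CNEnsemble) {β : ℝ} (hβ : 0 < β) (hβ1 : β ≤ 1)
    (hθ : ∀ t, β * M.intlam / M.Cparam * M.A t M.r ≤ 1 / 2)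
    {n₀ : ℕ} (hn₀ : M.Adm β n₀) :
    ∃ N : ℕ, 0 < N ∧ ∀ j : ℕ, 1 ≤ j → M.Adm β (j * N) ∧
      β / M.r * Real.log (Real.exp 1 * M.Cparam / (β * M.intlam)) -
      (2 * (M.intlam / M.Cparam) ^ 2 * ∑ t, (M.A t M.r : ℝ) ^ 2 * (M.ρ t / M.s t / M.intlam)) * β ^ 2
        - M.nc * (Real.log (((j * N : ℕ) : ℝ) + 1) + 1) / (j * N : ℕ) ≤
      Real.log (M.NcCount (j * N) ⌊β * ((j * N : ℕ) : ℝ)⌋₊) / (j * N : ℕ) := by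
  have hL := M.aux_intlam_pos
  have hC := M.aux_C_pos
  have hrn := M.aux_r_pos
  have hr : (0:ℝ) < M.r := by exact_mod_cast M.aux_r_pos
  have hn0 : (0:ℝ) < n₀ := by exact_mod_cast hn₀.1
  set θ := β * M.intlam / M.Cparam with hθdef
  have hθ0 : 0 < θ := by positivity
  have h5 : ∑ t, M.ρ t * (M.A t M.r : ℝ) / (M.s t : ℝ) = M.Cparam / M.r := by
    rw [aux_C_eq]; field_simp
  set K := ∑ t, M.cExp n₀ t * M.A t M.r with hK
  have hKr : (K:ℝ) = n₀ / M.intlam * (M.Cparam / M.r) := by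
    rw [hK, ← h5, Finset.mul_sum]
    push_cast
    refine Finset.sum_congr rfl fun t _ => ?_
    rw [M.aux_c hn₀]; ring
  have hKpos : 0 < K := by
    have : (0:ℝ) < K := by rw [hKr]; positivity
    exact_mod_cast this
  refine ⟨M.r * K * n₀, by have := hn₀.1; positivity, fun j hj => ?_⟩
  have hadm : M.Adm β (j * (M.r * K * n₀)) := by
    rw [← mul_assoc]
    exact M.aux_adm_mul hn₀ _ (Nat.one_le_iff_ne_zero.2 (by positivity))
  refine ⟨hadm, ?_⟩
  set n := j * (M.r * K * n₀) with hn
  have hnr : (n:ℝ) = j * (M.r * K * n₀) := by rw [hn]; push_cast; ring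
  have hnpos : (0:ℝ) < n := by exact_mod_cast hadm.1
  set v₀ := ⌊β * (n₀ : ℝ)⌋₊ with hv₀
  have hv₀r : (v₀:ℝ) = β * n₀ := hn₀.2.2.2.1
  set v := ⌊β * (n : ℝ)⌋₊ with hv
  have hvr : (v:ℝ) = β * n := hadm.2.2.2.1
  let w : Fin M.nc → ℕ := fun t => j * v₀ * M.cExp n₀ t * M.A t M.r
  have hw : ∀ t, (w t : ℝ) = θ * M.A t M.r * M.cExp n t := by
    intro t
    have : (w t : ℝ) = j * v₀ * M.cExp n₀ t * M.A t M.r := by simp [w]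
    rw [this, M.aux_c hn₀, M.aux_c hadm, hv₀r, hnr, hKr, hθdef]
    field_simp
  have hsum : ∑ t, M.r * w t = v := by
    have e : ∑ t, M.r * w t = j * M.r * v₀ * K := by
      rw [hK, Finset.mul_sum]
      refine Finset.sum_congr rfl fun t _ => ?_
      simp only [w]; ring
    have : ((∑ t, M.r * w t : ℕ) : ℝ) = v := by
      rw [e, hvr, hnr]; push_cast; rw [hv₀r]; ring
    exact_mod_cast this
  have hwn : ∀ t, (w t : ℝ) ≤ n := by
    intro t
    have h1 : M.r * w t ≤ v := by
      rw [← hsum]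
      exact Finset.single_le_sum (f := fun t => M.r * w t) (fun _ _ => Nat.zero_le _)
        (Finset.mem_univ t)
    have h2 : w t ≤ v := le_trans (Nat.le_mul_of_pos_left _ hrn) h1
    have h3 : (w t : ℝ) ≤ v := by exact_mod_cast h2
    rw [hvr] at h3
    nlinarith
  have hA : ∏ t, ((M.cExp n t).choose (w t) : ℝ) * (M.A t M.r : ℝ) ^ w t ≤ M.NcCount n v := by
    unfold NcCount
    rw [← hsum]
    refine le_trans ?_ (aux_coeff_prod Finset.univ (fun t => M.Apoly t ^ M.cExp n t)
      (fun t => aux_nn_pow (M.aux_nn t) _) (fun t => M.r * w t))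
    refine Finset.prod_le_prod (fun t _ => by positivity) fun t _ => ?_
    have := aux_coeff_pow (M.aux_nn t) (by rw [aux_coeff, M.hA0]; simp) M.r hrn (M.cExp n t) (w t)
    rwa [aux_coeff] at this
  have hpos : ∀ t, 0 < ((M.cExp n t).choose (w t) : ℝ) * (M.A t M.r : ℝ) ^ w t := by
    intro t
    have hle : w t ≤ M.cExp n t := by
      have : (w t : ℝ) ≤ M.cExp n t := by
        rw [hw]
        have := mul_le_mul_of_nonneg_right (hθ t) (Nat.cast_nonneg (α := ℝ) (M.cExp n t))
        have h0 := (Nat.cast_nonneg (α := ℝ) (M.cExp n t))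
        linarith
      exact_mod_cast this
    have h1 : (0:ℝ) < (M.cExp n t).choose (w t) := by exact_mod_cast Nat.choose_pos hle
    refine mul_pos h1 ?_
    rcases Nat.eq_zero_or_pos (M.A t M.r) with h | h
    · have : w t = 0 := by simp [w, h]
      rw [this]; simp
    · have : (0:ℝ) < M.A t M.r := by exact_mod_cast h
      positivity
  have hB := Real.log_le_log (Finset.prod_pos fun t _ => hpos t) hA
  rw [Real.log_prod (fun t _ => (hpos t).ne')] at hB
  have hterm : ∀ t ∈ (Finset.univ : Finset (Fin M.nc)),
      w t * Real.log (Real.exp 1 / θ) - 2 * θ ^ 2 * n * ((M.A t M.r : ℝ) ^ 2 * (M.ρ t / M.s t / M.intlam))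
        - (Real.log ((n:ℝ) + 1) + 1) ≤
      Real.log (((M.cExp n t).choose (w t) : ℝ) * (M.A t M.r : ℝ) ^ w t) := by
    intro t _
    have e := aux_term_s17 (M.cExp n t) (w t) (M.A t M.r) θ hθ0 (hw t) (hθ t)
    have e2 : Real.log ((w t : ℝ) + 1) ≤ Real.log ((n:ℝ) + 1) :=
      Real.log_le_log (by positivity) (by linarith [hwn t])
    have e3 : 2 * θ ^ 2 * (M.A t M.r : ℝ) ^ 2 * M.cExp n t =
      2 * θ ^ 2 * n * ((M.A t M.r : ℝ) ^ 2 * (M.ρ t / M.s t / M.intlam)) := by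
      rw [M.aux_c hadm]; ring
    rw [e3] at e
    linarith
  have hD := (Finset.sum_le_sum hterm).trans hB
  rw [Finset.sum_sub_distrib, Finset.sum_sub_distrib, ← Finset.sum_mul, ← Finset.mul_sum,
    Finset.sum_const, Finset.card_univ, Fintype.card_fin, nsmul_eq_mul] at hD
  have hwsum : ∑ t, (w t : ℝ) = β * n / M.r := by
    rw [← hvr, ← hsum]; push_cast; rw [← Finset.mul_sum]; field_simp
  rw [hwsum] at hD
  have h8 : Real.exp 1 * M.Cparam / (β * M.intlam) = Real.exp 1 / θ := by
    rw [hθdef]; field_simp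
  rw [h8, le_div_iff₀ hnpos]
  refine le_trans (le_of_eq ?_) hD
  rw [hθdef]
  field_simp

end CNEnsemble

lemma aux_nn_binom (E : ℕ) : ∀ i, 0 ≤ ((1 + X : Polynomial ℝ) ^ E).coeff i := by
  intro i
  rw [Polynomial.coeff_one_add_X_pow]; positivity

lemma aux_choose_mul (E F v w : ℕ) :
    (E.choose v : ℝ) * F.choose w ≤ ((E + F).choose (v + w) : ℝ) := by
  have := aux_coeff_mul (aux_nn_binom E) (aux_nn_binom F) v w
  rwa [← pow_add, Polynomial.coeff_one_add_X_pow, Polynomial.coeff_one_add_X_pow,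
    Polynomial.coeff_one_add_X_pow] at this

lemma aux_choose_upper (E v : ℕ) (x : ℝ) (hx : 0 < x) (hv : v ≤ E) :
    Real.log (E.choose v : ℝ) ≤ E * x - v * Real.log x := by
  have h := aux_eval (aux_nn_binom E) x hx.le v
  rw [Polynomial.coeff_one_add_X_pow] at h
  simp only [Polynomial.eval_pow, Polynomial.eval_add, Polynomial.eval_one,
    Polynomial.eval_X] at h
  have hc : (0:ℝ) < E.choose v := by exact_mod_cast Nat.choose_pos hv
  have h2 := Real.log_le_log (by positivity) h
  rw [Real.log_mul hc.ne' (by positivity), Real.log_pow, Real.log_pow] at h2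
  have h3 := Real.log_le_sub_one_of_pos (show 0 < 1 + x by linarith)
  have h4 := mul_le_mul_of_nonneg_left h3 (Nat.cast_nonneg (α := ℝ) E)
  linarith

lemma aux_log_div : Tendsto (fun n : ℕ => (Real.log ((n:ℝ) + 1) + 1) / n) atTop (nhds 0) := by
  have h1 : Tendsto (fun x : ℝ => (Real.log (x + 1) + 1) / x) atTop (nhds 0) := by
    have hl : (fun x : ℝ => Real.log x) =o[atTop] (fun x : ℝ => x) := Real.isLittleO_log_id_atTop
    have ht : Tendsto (fun x : ℝ => x + 1) atTop atTop := tendsto_atTop_add_const_right _ _ tendsto_id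
    have hc : (fun _ : ℝ => (1:ℝ)) =o[atTop] (fun x : ℝ => x) :=
      Asymptotics.isLittleO_const_id_atTop 1
    have h2 := hl.comp_tendsto ht
    have h3 : (fun x : ℝ => x + 1) =O[atTop] (fun x : ℝ => x) :=
      (Asymptotics.isBigO_refl _ _).add hc.isBigO
    exact ((h2.trans_isBigO h3).add hc).tendsto_div_nhds_zero
  exact h1.comp tendsto_natCast_atTop_atTop


/-- **Exponential behavior of the probability that a random assignment is check-valid.**
For every sufficiently small admissible rational `β > 0`, the limit
`Y(β) = lim_n (1/n) log P_valid(βn)` exists (along the admissible `n`), and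
`Y(β) = (β/r) log(e C/(β ∫λ)) - β log(e/(β ∫λ)) + O(β^{min{r̄/r,2}})` as `β → 0⁺`. -/
theorem prob_check_valid_exponential (M : CNEnsemble) :
    ∃ k : ℝ, 0 < k ∧ ∃ ε : ℝ, 0 < ε ∧
      ∀ β : ℚ, 0 < β → (β : ℝ) ≤ ε → {n : ℕ | M.Adm (β : ℝ) n}.Infinite →
        ∃ Y : ℝ,
          Filter.Tendsto
            (fun n : ℕ => (1 / (n : ℝ)) * Real.log (M.Pvalid (β : ℝ) n))
            (Filter.atTop ⊓ Filter.principal {n : ℕ | M.Adm (β : ℝ) n}) (nhds Y) ∧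
          |Y - (((β : ℝ) / (M.r : ℝ)) *
              Real.log (Real.exp 1 * M.Cparam / ((β : ℝ) * M.intlam)) -
            (β : ℝ) * Real.log (Real.exp 1 / ((β : ℝ) * M.intlam)))| ≤
            k * (β : ℝ) ^ M.expo := by
  have hL := M.aux_intlam_pos
  have hC := M.aux_C_pos
  have hr : (0:ℝ) < M.r := by exact_mod_cast M.aux_r_pos
  set L := M.intlam with hLdef
  set C := M.Cparam with hCdef
  set D1 : ℝ := (∑ t, M.ρ t / M.s t / L * ∑ u ∈ Finset.range (M.s t + 1), (M.A t u : ℝ)) *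
        (L / C) ^ M.expo with hD1
  set D2 : ℝ := 2 * (L / C) ^ 2 * ∑ t, (M.A t M.r : ℝ) ^ 2 * (M.ρ t / M.s t / L) with hD2
  have hD1n : 0 ≤ D1 := by
    refine mul_nonneg (Finset.sum_nonneg fun t _ => ?_) (by positivity)
    have := M.hρpos t
    positivity
  have hD2n : 0 ≤ D2 := by
    refine mul_nonneg (by positivity) (Finset.sum_nonneg fun t _ => ?_)
    have := M.hρpos t
    positivity
  set SA : ℝ := ∑ t, (M.A t M.r : ℝ) with hSA
  have hSAn : 0 ≤ SA := Finset.sum_nonneg fun t _ => by positivity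
  refine ⟨D1 + D2 + 2 * L + 1, by positivity,
    min (min 1 (1 / (2 * L))) (C / (2 * L * (1 + SA))), by positivity, ?_⟩
  intro βq hβq hβε hinf
  set β : ℝ := (βq : ℝ) with hβdef
  have hβ : 0 < β := by rw [hβdef]; exact_mod_cast hβq
  have hβ1 : β ≤ 1 := hβε.trans ((min_le_left _ _).trans (min_le_left _ _))
  have hβL : β * L ≤ 1 / 2 := by
    have := hβε.trans ((min_le_left _ _).trans (min_le_right _ _))
    rw [le_div_iff₀ (by positivity)] at this
    linarith
  have hβC : β * L / C * (1 + SA) ≤ 1 / 2 := by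
    have := hβε.trans (min_le_right _ _)
    rw [le_div_iff₀ (by positivity)] at this
    rw [div_mul_eq_mul_div, div_le_iff₀ hC]
    linarith
  have hθ0 : 0 < β * L / C := by positivity
  have hθ1 : β * L / C ≤ 1 := by nlinarith
  have hθA : ∀ t, β * L / C * M.A t M.r ≤ 1 / 2 := by
    intro t
    have : (M.A t M.r : ℝ) ≤ SA :=
      Finset.single_le_sum (f := fun t => (M.A t M.r : ℝ)) (fun _ _ => by positivity)
        (Finset.mem_univ t)
    nlinarith
  have hβe : β ^ 2 ≤ β ^ M.expo := by
    rw [← Real.rpow_natCast β 2]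
    exact Real.rpow_le_rpow_of_exponent_ge hβ hβ1 (by exact_mod_cast M.aux_expo_le_two)
  set S : Set ℕ := {n : ℕ | M.Adm β n} with hS
  have hSne : S.Nonempty := hinf.nonempty
  have hadd : ∀ n ∈ S, ∀ m ∈ S, n + m ∈ S := fun n hn m hm => (M.aux_add hn hm).2.2.2.2
  have hpos : ∀ n ∈ S, 0 < n := fun n hn => hn.1
  have hvE : ∀ n ∈ S, ((⌊β * (n : ℝ)⌋₊ : ℕ) : ℝ) = β * L * (M.En n : ℝ) := by
    intro n hn
    rw [hn.2.2.2.1, hn.2.1, ← hLdef]; field_simp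
  have hvle : ∀ n ∈ S, ⌊β * (n : ℝ)⌋₊ ≤ M.En n := by
    intro n hn
    have h := hvE n hn
    have : ((⌊β * (n : ℝ)⌋₊ : ℕ) : ℝ) ≤ (M.En n : ℝ) := by
      rw [h]
      have := Nat.cast_nonneg (α := ℝ) (M.En n)
      nlinarith
    exact_mod_cast this
  have hcpos : ∀ n ∈ S, (0:ℝ) < (M.En n).choose ⌊β * (n : ℝ)⌋₊ := by
    intro n hn
    exact_mod_cast Nat.choose_pos (hvle n hn)
  obtain ⟨Y1, hY1⟩ := aux_fekete S hpos hadd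
    (fun n => Real.log (M.NcCount n ⌊β * (n : ℝ)⌋₊))
    (fun n hn m hm => by
      have hn' : M.Adm β n := hn
      have hm' : M.Adm β m := hm
      rw [← Real.log_mul hn'.2.2.2.2.ne' hm'.2.2.2.2.ne']
      exact Real.log_le_log (mul_pos hn'.2.2.2.2 hm'.2.2.2.2) (M.aux_add hn hm).2.2.2.1)
    _ (fun n hn => M.aux_upper hβ hθ1 hn) hSne
  have hlogeq : Real.log (Real.exp 1 / (β * L)) = 1 - Real.log (β * L) := by
    rw [Real.log_div (by positivity) (by positivity), Real.log_exp]
  have hup2 : ∀ n ∈ S, Real.log ((M.En n).choose ⌊β * (n : ℝ)⌋₊ : ℝ) / n ≤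
      β * Real.log (Real.exp 1 / (β * L)) := by
    intro n hn
    have hn0 : (0:ℝ) < n := by exact_mod_cast hpos n hn
    have h := aux_choose_upper _ _ (β * L) (by positivity) (hvle n hn)
    rw [hn.2.2.2.1, hn.2.1, ← hLdef] at h
    rw [div_le_iff₀ hn0, hlogeq]
    refine h.trans (le_of_eq ?_)
    field_simp
  obtain ⟨Y2, hY2⟩ := aux_fekete S hpos hadd
    (fun n => Real.log ((M.En n).choose ⌊β * (n : ℝ)⌋₊ : ℝ))
    (fun n hn m hm => by
      rw [← Real.log_mul (hcpos n hn).ne' (hcpos m hm).ne']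
      refine Real.log_le_log (mul_pos (hcpos n hn) (hcpos m hm)) ?_
      rw [(M.aux_add hn hm).1, (M.aux_add hn hm).2.2.1]
      exact aux_choose_mul _ _ _ _)
    _ hup2 hSne
  have hNB : (atTop ⊓ 𝓟 S : Filter ℕ).NeBot := by
    rw [← Filter.frequently_mem_iff_neBot]
    exact Nat.frequently_atTop_iff_infinite.2 hinf
  have hin : ∀ᶠ n in (atTop ⊓ 𝓟 S : Filter ℕ), n ∈ S :=
    eventually_inf_principal.2 (Eventually.of_forall fun n h => h)
  have b1 : Y1 ≤ β / M.r * Real.log (Real.exp 1 * C / (β * L)) + D1 * β ^ M.expo :=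
    le_of_tendsto hY1 (hin.mono fun n hn => M.aux_upper hβ hθ1 hn)
  have b2 : Y2 ≤ β * Real.log (Real.exp 1 / (β * L)) := le_of_tendsto hY2 (hin.mono hup2)
  have b3 : β * Real.log (Real.exp 1 / (β * L)) - 2 * L * β ^ 2 ≤ Y2 := by
    have ht : Tendsto (fun n : ℕ => β * Real.log (Real.exp 1 / (β * L)) - 2 * L * β ^ 2
        - (Real.log ((n:ℝ) + 1) + 1) / n) (atTop ⊓ 𝓟 S)
        (nhds (β * Real.log (Real.exp 1 / (β * L)) - 2 * L * β ^ 2 - 0)) :=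
      tendsto_const_nhds.sub (aux_log_div.mono_left inf_le_left)
    rw [sub_zero] at ht
    refine le_of_tendsto_of_tendsto ht hY2 (hin.mono fun n hn => ?_)
    have hn0 : (0:ℝ) < n := by exact_mod_cast hpos n hn
    have e := aux_term_s17 (M.En n) ⌊β * (n : ℝ)⌋₊ 1 (β * L) (by positivity)
      (by rw [hvE n hn]; simp) (by simpa using hβL)
    rw [hn.2.2.2.1, hn.2.1, ← hLdef] at e
    simp only [Nat.cast_one, one_pow, mul_one] at e
    have e2 : Real.log (β * n + 1) ≤ Real.log ((n:ℝ) + 1) :=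
      Real.log_le_log (by positivity) (by nlinarith)
    rw [le_div_iff₀ hn0, sub_mul, div_mul_cancel₀ _ hn0.ne']
    have e3 : 2 * (β * L) ^ 2 * (n / L) = 2 * L * β ^ 2 * n := by field_simp
    rw [e3] at e
    linarith
  have b4 : β / M.r * Real.log (Real.exp 1 * C / (β * L)) - D2 * β ^ 2 ≤ Y1 := by
    obtain ⟨n₀, hn₀⟩ := hSne
    obtain ⟨N, hN, hj⟩ := M.aux_lower hβ hβ1 hθA hn₀
    have hsub : Tendsto (fun j : ℕ => j * N) atTop atTop :=
      tendsto_id.atTop_mul_const' hN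
    have hsub' : Tendsto (fun j : ℕ => j * N) atTop (atTop ⊓ 𝓟 S) := by
      refine tendsto_inf.2 ⟨hsub, tendsto_principal.2 ?_⟩
      filter_upwards [eventually_ge_atTop 1] with j h1
      exact (hj j h1).1
    have hY1' := hY1.comp hsub'
    have ht := ((aux_log_div.comp hsub).const_mul (M.nc : ℝ)).const_sub
      (β / M.r * Real.log (Real.exp 1 * C / (β * L)) - D2 * β ^ 2)
    rw [mul_zero, sub_zero] at ht
    refine le_of_tendsto_of_tendsto ht hY1' ?_
    filter_upwards [eventually_ge_atTop 1] with j h1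
    have := (hj j h1).2
    rw [mul_div_assoc (M.nc : ℝ)] at this
    exact this
  refine ⟨Y1 - Y2, ?_, ?_⟩
  · refine (hY1.sub hY2).congr' (hin.mono fun n hn => ?_)
    have hn' : M.Adm β n := hn
    unfold CNEnsemble.Pvalid
    beta_reduce
    rw [Real.log_div hn'.2.2.2.2.ne' (hcpos n hn).ne']
    ring
  · have p0 : 0 ≤ β ^ M.expo := by positivity
    have p1 := mul_le_mul_of_nonneg_left hβe hD2n
    have p2 := mul_le_mul_of_nonneg_left hβe (show 0 ≤ 2 * L by positivity)
    have p3 := mul_nonneg hD1n p0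
    have p4 := mul_nonneg hD2n p0
    have p5 := mul_nonneg hL.le p0
    rw [abs_le]
    constructor <;> nlinarith
end

section
/- Closed form of the entropy-type constrained maximizer. Let V be a nonempty finite index set, for each v in V let a_v > 0 be a real and i_v >= 1 an integer, and let delta > 0. Consider maximizing f(upsilon) = sum_{v in V} upsilon_v log( e a_v / (delta upsilon_v) ) over vectors upsilon = (upsilon_v)_{v in V} with upsilon_v >= 0 and sum_{v in V} i_v upsilon_v = 1 (terms with upsilon_v = 0 interpreted as 0). Then: (a) the equation sum_{v in V} i_v a_v z^{i_v} = delta has a unique positive real solution z; and (b) the maximum of f is attained at the unique point upsilon* given by upsilon*_v = (a_v / delta) z^{i_v} for all v in V, and at no other feasible point. -/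
open Finset

theorem aux_point (a δ z u : ℝ) (n : ℕ) (ha : 0 < a) (hδ : 0 < δ) (hz : 0 < z) (hu : 0 ≤ u) :
    u * Real.log (Real.exp 1 * a / (δ * u)) ≤ (a / δ) * z ^ n - Real.log z * ((n : ℝ) * u) ∧
    (u * Real.log (Real.exp 1 * a / (δ * u)) = (a / δ) * z ^ n - Real.log z * ((n : ℝ) * u) ↔
      u = (a / δ) * z ^ n) := by
  have hp : 0 < (a / δ) * z ^ n := by positivity
  rcases hu.eq_or_lt with h | h
  · subst h
    simp only [zero_mul, mul_zero, sub_zero]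
    exact ⟨hp.le, trivial⟩
  · have e1 : Real.log (Real.exp 1 * a / (δ * u))
        = 1 + Real.log (((a / δ) * z ^ n) / u) - n * Real.log z := by
      rw [Real.log_div (by positivity) (by positivity), Real.log_mul (by positivity) ha.ne',
        Real.log_mul hδ.ne' h.ne', Real.log_exp, Real.log_div hp.ne' h.ne',
        Real.log_mul (by positivity) (by positivity), Real.log_div ha.ne' hδ.ne', Real.log_pow]
      ring
    rw [e1]
    set p := (a / δ) * z ^ n
    have hq : 0 < p / u := by positivity
    have hup : u * (p / u) = p := by field_simp
    refine ⟨?_, ?_, ?_⟩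
    · have := mul_le_mul_of_nonneg_left (Real.log_le_sub_one_of_pos hq) hu
      nlinarith
    · intro he
      by_contra hne
      have h1 : p / u ≠ 1 := by
        intro h1
        rw [h1] at hup
        apply hne
        linarith
      have := mul_lt_mul_of_pos_left (Real.log_lt_sub_one_of_pos hq h1) h
      nlinarith
    · intro he
      rw [← he, div_self h.ne', Real.log_one]
      ring

/-- **Closed form of the entropy-type constrained maximizer.**
For positive reals `a_v`, integers `i_v ≥ 1` and `δ > 0`, consider maximizing
`f(υ) = ∑_v υ_v log(e a_v/(δ υ_v))` over `υ ≥ 0` with `∑_v i_v υ_v = 1`.  Then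
(a) the equation `∑_v i_v a_v z^{i_v} = δ` has a unique positive real solution `z`, and
(b) the maximum of `f` is attained at the feasible point `υ*_v = (a_v/δ) z^{i_v}`, and
at no other feasible point.  (Terms with `υ_v = 0` vanish automatically in Lean.) -/
theorem entropy_constrained_maximizer_closed_form {ι : Type*} [Fintype ι] [Nonempty ι]
    (a : ι → ℝ) (ha : ∀ v, 0 < a v)
    (iv : ι → ℕ) (hiv : ∀ v, 1 ≤ iv v)
    (δ : ℝ) (hδ : 0 < δ) :
    (∃! z : ℝ, 0 < z ∧ ∑ v, (iv v : ℝ) * a v * z ^ iv v = δ) ∧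
    (∀ z : ℝ, 0 < z → (∑ v, (iv v : ℝ) * a v * z ^ iv v = δ) →
      ((∀ v, 0 ≤ (a v / δ) * z ^ iv v) ∧
        (∑ v, (iv v : ℝ) * ((a v / δ) * z ^ iv v) = 1)) ∧
      (∀ υ : ι → ℝ, (∀ v, 0 ≤ υ v) → (∑ v, (iv v : ℝ) * υ v = 1) →
        ∑ v, υ v * Real.log (Real.exp 1 * a v / (δ * υ v)) ≤
          ∑ v, ((a v / δ) * z ^ iv v) *
            Real.log (Real.exp 1 * a v / (δ * ((a v / δ) * z ^ iv v)))) ∧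
      (∀ υ : ι → ℝ, (∀ v, 0 ≤ υ v) → (∑ v, (iv v : ℝ) * υ v = 1) →
        (∑ v, υ v * Real.log (Real.exp 1 * a v / (δ * υ v)) =
          ∑ v, ((a v / δ) * z ^ iv v) *
            Real.log (Real.exp 1 * a v / (δ * ((a v / δ) * z ^ iv v)))) →
        υ = fun v => (a v / δ) * z ^ iv v)) := by
  have hmono : StrictMonoOn (fun z : ℝ => ∑ v, (iv v : ℝ) * a v * z ^ iv v) (Set.Ici 0) := by
    intro x hx y _ hxy
    refine Finset.sum_lt_sum_of_nonempty Finset.univ_nonempty fun v _ => ?_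
    have h1 : (0 : ℝ) < iv v := by exact_mod_cast hiv v
    have h2 := ha v
    exact mul_lt_mul_of_pos_left (pow_lt_pow_left₀ hxy hx (by have := hiv v; omega))
      (by positivity)
  refine ⟨?_, ?_⟩
  · obtain ⟨v0⟩ := ‹Nonempty ι›
    have hM : (0 : ℝ) ≤ 1 + δ / a v0 := by have := ha v0; positivity
    have hc : ContinuousOn (fun z : ℝ => ∑ v, (iv v : ℝ) * a v * z ^ iv v)
        (Set.Icc 0 (1 + δ / a v0)) := by fun_prop
    have h0 : ∑ v, (iv v : ℝ) * a v * (0 : ℝ) ^ iv v = 0 := by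
      refine Finset.sum_eq_zero fun v _ => ?_
      rw [zero_pow (by have := hiv v; omega), mul_zero]
    have hbig : δ ≤ ∑ v, (iv v : ℝ) * a v * (1 + δ / a v0) ^ iv v := by
      have h3 : (iv v0 : ℝ) * a v0 * (1 + δ / a v0) ^ iv v0
          ≤ ∑ v, (iv v : ℝ) * a v * (1 + δ / a v0) ^ iv v :=
        Finset.single_le_sum (f := fun v => (iv v : ℝ) * a v * (1 + δ / a v0) ^ iv v)
          (fun v _ => by have := ha v; positivity) (Finset.mem_univ v0)
      have hp := ha v0
      have h4 : 1 + δ / a v0 ≤ (1 + δ / a v0) ^ iv v0 :=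
        le_self_pow₀ (by have : 0 ≤ δ / a v0 := by positivity
                         linarith) (by have := hiv v0; omega)
      have h5 : (1 : ℝ) ≤ iv v0 := by exact_mod_cast hiv v0
      have h6 : a v0 * (1 + δ / a v0) = a v0 + δ := by field_simp
      have h7 : 1 * a v0 * (1 + δ / a v0) ≤ (iv v0 : ℝ) * a v0 * (1 + δ / a v0) ^ iv v0 := by
        gcongr
      linarith
    obtain ⟨z, hz, hzδ⟩ := intermediate_value_Icc hM hc ⟨by simpa only [h0] using hδ.le, hbig⟩
    have hzδ' : ∑ v, (iv v : ℝ) * a v * z ^ iv v = δ := hzδ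
    have hzpos : 0 < z := by
      rcases hz.1.eq_or_lt with h | h
      · rw [← h, h0] at hzδ'
        exact absurd hzδ' hδ.ne
      · exact h
    refine ⟨z, ⟨hzpos, hzδ'⟩, ?_⟩
    rintro y ⟨hy, hyδ⟩
    exact hmono.injOn hy.le hzpos.le (hyδ.trans hzδ'.symm)
  · intro z hz hzδ
    have hnn : ∀ v, 0 ≤ (a v / δ) * z ^ iv v := fun v => by have := ha v; positivity
    have hsum : ∑ v, (iv v : ℝ) * ((a v / δ) * z ^ iv v) = 1 := by
      have : ∑ v, (iv v : ℝ) * ((a v / δ) * z ^ iv v)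
          = (∑ v, (iv v : ℝ) * a v * z ^ iv v) / δ := by
        rw [Finset.sum_div]
        exact Finset.sum_congr rfl fun v _ => by ring
      rw [this, hzδ, div_self hδ.ne']
    have hR : ∀ υ : ι → ℝ, (∑ v, (iv v : ℝ) * υ v = 1) →
        ∑ v, ((a v / δ) * z ^ iv v - Real.log z * ((iv v : ℝ) * υ v))
          = ∑ v, (a v / δ) * z ^ iv v - Real.log z := by
      intro υ h
      rw [Finset.sum_sub_distrib, ← Finset.mul_sum, h, mul_one]
    have hstar : ∑ v, ((a v / δ) * z ^ iv v) *
            Real.log (Real.exp 1 * a v / (δ * ((a v / δ) * z ^ iv v)))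
          = ∑ v, (a v / δ) * z ^ iv v - Real.log z := by
      rw [← hR _ hsum]
      exact Finset.sum_congr rfl fun v _ =>
        (aux_point (a v) δ z _ (iv v) (ha v) hδ hz (hnn v)).2.2 rfl
    refine ⟨⟨hnn, hsum⟩, ?_, ?_⟩
    · intro υ h0 h1
      rw [hstar, ← hR υ h1]
      exact Finset.sum_le_sum fun v _ => (aux_point (a v) δ z _ (iv v) (ha v) hδ hz (h0 v)).1
    · intro υ h0 h1 he
      rw [hstar, ← hR υ h1] at he
      have := (Finset.sum_eq_sum_iff_of_le fun v _ =>
        (aux_point (a v) δ z _ (iv v) (ha v) hδ hz (h0 v)).1).1 he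
      funext v
      exact (aux_point (a v) δ z _ (iv v) (ha v) hδ hz (h0 v)).2.1 (this v (Finset.mem_univ v))
end
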